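/- arXiv:1805.12479 — 11 statements merged into one kernel-verified Lean document; each statement's English description precedes it below -/
import Mathlib

section
/- Let X be a set, let β : X × X → ℝ be a kernel of hyperbolic type, and let 0 ≤ t ≤ 1. Then the pointwise power β^t, i.e. the kernel (x,y) ↦ (β(x,y))^t, is again a kernel of hyperbolic type on X. -/
open scoped RealInnerProductSpace

variable (H : Type*) [NormedAddCommGroup H] [InnerProductSpace ℝ H]

/-- The Minkowski bilinear form on `ℝ × H`. -/
noncomputable def minkB (v w : ℝ × H) : ℝ := v.1 * w.1 - ⟪v.2, w.2⟫

/-- The hyperboloid model of hyperbolic space inside `ℝ × H`. -/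
noncomputable def Hyp : Set (ℝ × H) := {v | minkB H v v = 1 ∧ 0 < v.1}

/-- Inverse hyperbolic cosine. -/
noncomputable def arcosh (x : ℝ) : ℝ := Real.log (x + Real.sqrt (x ^ 2 - 1))

/-- The hyperbolic distance on the hyperboloid. -/
noncomputable def hypDist (x y : ℝ × H) : ℝ := arcosh (minkB H x y)

/-- A subset of the hyperboloid is hyperbolically total if its closed linear span
is all of `ℝ × H`. -/
def HypTotal (S : Set (ℝ × H)) : Prop :=
  (Submodule.span ℝ S).topologicalClosure = ⊤

/-- A kernel of hyperbolic type. -/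
def IsHypKernel {X : Type*} (β : X → X → ℝ) : Prop :=
  (∀ x y, β x y = β y x) ∧ (∀ x y, 0 ≤ β x y) ∧ (∀ x, β x x = 1) ∧
    ∀ (n : ℕ) (x₀ : X) (x : Fin n → X) (c : Fin n → ℝ),
      ∑ i, ∑ j, c i * c j * β (x i) (x j) ≤ (∑ k, c k * β (x k) x₀) ^ 2

/-- A kernel of conditionally negative type. -/
def IsCNDKernel {X : Type*} (ψ : X → X → ℝ) : Prop :=
  (∀ x y, ψ x y = ψ y x) ∧ (∀ x, ψ x x = 0) ∧
    ∀ (n : ℕ) (x : Fin n → X) (c : Fin n → ℝ), (∑ i, c i = 0) →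
      ∑ i, ∑ j, c i * c j * ψ (x i) (x j) ≤ 0

/-- The group `O₊(B)` of continuous linear automorphisms of `ℝ × H` preserving the
Minkowski form and the upper hyperboloid sheet. -/
noncomputable def Oplus : Subgroup ((ℝ × H) ≃L[ℝ] (ℝ × H)) where
  carrier := {g | (∀ v w, minkB H (g v) (g w) = minkB H v w) ∧
    ∀ v, v ∈ Hyp H ↔ g v ∈ Hyp H}
  one_mem' := ⟨fun _ _ => rfl, fun _ => Iff.rfl⟩
  mul_mem' := by
    rintro a b ⟨ha1, ha2⟩ ⟨hb1, hb2⟩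
    refine ⟨fun v w => ?_, fun v => ?_⟩
    · show minkB H (a (b v)) (a (b w)) = _
      rw [ha1, hb1]
    · show v ∈ Hyp H ↔ a (b v) ∈ Hyp H
      rw [← ha2, ← hb2]
  inv_mem' := by
    rintro a ⟨ha1, ha2⟩
    refine ⟨fun v w => ?_, fun v => ?_⟩
    · show minkB H (a.symm v) (a.symm w) = minkB H v w
      conv_rhs => rw [← a.apply_symm_apply v, ← a.apply_symm_apply w, ha1]
    · show v ∈ Hyp H ↔ a.symm v ∈ Hyp H
      conv_lhs => rw [← a.apply_symm_apply v, ← ha2]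


theorem Real.neg_one_pow_mul_choose_succ_nonneg {t : ℝ} (ht0 : 0 ≤ t) (ht1 : t ≤ 1) (n : ℕ) :
    0 ≤ (-1) ^ n * Ring.choose t (n + 1) := by
  induction n with
  | zero => simpa using ht0
  | succ n ih =>
    have h := Ring.choose_smul_choose t (Nat.le_succ (n + 1))
    simp only [Nat.succ_eq_add_one, Nat.choose_succ_self_right, add_tsub_cancel_left,
      Ring.choose_one_right, nsmul_eq_mul] at h
    push_cast at h
    have hn : (0 : ℝ) < n + 1 + 1 := by positivity
    have key : (-1) ^ (n + 1) * Ring.choose t (n + 1 + 1) =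
        (-1) ^ n * Ring.choose t (n + 1) * (n + 1 - t) / (n + 1 + 1) := by
      rw [eq_div_iff hn.ne', pow_succ]
      linear_combination -(-1) ^ n * h
    rw [key]
    have : 0 ≤ (n : ℝ) + 1 - t := by
      have : (0 : ℝ) ≤ n := n.cast_nonneg
      linarith
    positivity

theorem Real.hasSum_one_sub_one_sub_rpow (t : ℝ) {z : ℝ} (hz : |z| < 1) :
    HasSum (fun n : ℕ => (-1) ^ n * Ring.choose t (n + 1) * z ^ (n + 1)) (1 - (1 - z) ^ t) := by
  have h := (Real.one_add_rpow_hasFPowerSeriesOnBall_zero (a := t)).hasSum (y := -z) (by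
    simpa [enorm_eq_nnnorm, ← NNReal.coe_lt_coe] using hz)
  simp only [binomialSeries_apply, List.ofFn_const, List.prod_replicate, smul_eq_mul,
    zero_add] at h
  rw [← hasSum_nat_add_iff' 1] at h
  have hconst : 1 - (1 - z) ^ t =
      -((1 + -z) ^ t - ∑ i ∈ Finset.range 1, Ring.choose t i * (-z) ^ i) := by
    simp [sub_eq_add_neg]
  have hterm : (fun n : ℕ => (-1) ^ n * Ring.choose t (n + 1) * z ^ (n + 1)) =
      fun n => -(Ring.choose t (n + 1) * (-z) ^ (n + 1)) := by
    ext n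
    rw [neg_pow z, pow_succ (-1 : ℝ)]
    ring
  rw [hconst, hterm]
  exact h.neg

theorem Matrix.PosSemidef.map_pow_succ {ι : Type*} {M : Matrix ι ι ℝ} (hM : M.PosSemidef)
    (n : ℕ) : (M.map (· ^ (n + 1))).PosSemidef := by
  induction n with
  | zero => simpa using hM
  | succ n ih =>
    have h : M.map (· ^ (n + 1 + 1)) = (M.map (· ^ (n + 1))).hadamard M := by
      ext i j
      simp [pow_succ]
    rw [h]
    exact ih.hadamard hM

theorem Matrix.PosSemidef.sum_mul_one_sub_one_sub_rpow_nonneg {ι : Type*} [Fintype ι]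
    {M : Matrix ι ι ℝ} (hM : M.PosSemidef) (hM1 : ∀ i j, |M i j| < 1) {t : ℝ}
    (ht0 : 0 ≤ t) (ht1 : t ≤ 1) (c : ι → ℝ) :
    0 ≤ ∑ i, ∑ j, c i * c j * (1 - (1 - M i j) ^ t) := by
  have hsum : HasSum (fun n : ℕ => ∑ i, ∑ j, c i * c j *
      ((-1) ^ n * Ring.choose t (n + 1) * M i j ^ (n + 1)))
      (∑ i, ∑ j, c i * c j * (1 - (1 - M i j) ^ t)) :=
    hasSum_sum fun i _ => hasSum_sum fun j _ =>
      (Real.hasSum_one_sub_one_sub_rpow t (hM1 i j)).mul_left _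
  refine hsum.nonneg fun n => ?_
  have h := mul_nonneg (Real.neg_one_pow_mul_choose_succ_nonneg ht0 ht1 n)
    ((hM.map_pow_succ n).dotProduct_mulVec_nonneg c)
  convert h using 1
  simp only [dotProduct, Matrix.mulVec, Finset.mul_sum, Matrix.map_apply, Pi.star_apply, star_trivial]
  refine Finset.sum_congr rfl fun i _ => Finset.sum_congr rfl fun j _ => ?_
  ring

namespace IsHypKernel

variable {X : Type*} {β : X → X → ℝ}

theorem pos (hβ : IsHypKernel β) (x y : X) : 0 < β x y := by
  obtain ⟨-, hnonneg, hdiag, hhyp⟩ := hβ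
  have h := hhyp 1 y (fun _ => x) (fun _ => 1)
  simp only [Fin.sum_univ_one, hdiag, one_mul] at h
  refine (hnonneg x y).lt_of_ne fun h0 => ?_
  rw [← h0] at h
  norm_num at h

theorem lt_two_mul (hβ : IsHypKernel β) (x y z : X) : β x y < 2 * (β x z * β y z) := by
  have hx := hβ.pos x z
  have hy := hβ.pos y z
  obtain ⟨hsymm, -, hdiag, hhyp⟩ := hβ
  have h := hhyp 2 z ![x, y] ![β y z, β x z]
  simp only [Fin.sum_univ_two, Matrix.cons_val_zero, Matrix.cons_val_one, hdiag, hsymm y x] at h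
  have hxy := mul_pos hx hy
  by_contra! hle
  nlinarith [mul_le_mul_of_nonneg_left hle hxy.le, mul_pos hx hx, mul_pos hy hy]

theorem posSemidef (hβ : IsHypKernel β) {n : ℕ} (x₀ : X) (x : Fin n → X) :
    (Matrix.of fun i j => 1 - β (x i) (x j) / (β (x i) x₀ * β (x j) x₀)).PosSemidef := by
  refine Matrix.PosSemidef.of_dotProduct_mulVec_nonneg ?_ fun c => ?_
  · ext i j
    simp [hβ.1 (x j) (x i), mul_comm]
  · have h := hβ.2.2.2 n x₀ x (fun i => c i / β (x i) x₀)
    simp only [div_mul_cancel₀ _ (hβ.pos _ _).ne'] at h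
    rw [sq, Finset.sum_mul_sum, ← sub_nonneg, ← Finset.sum_sub_distrib] at h
    refine h.trans_eq ?_
    simp only [dotProduct, Matrix.mulVec, Finset.mul_sum, ← Finset.sum_sub_distrib,
      Matrix.of_apply, Pi.star_apply, star_trivial]
    refine Finset.sum_congr rfl fun i _ => Finset.sum_congr rfl fun j _ => ?_
    ring

end IsHypKernel

/-- a pointwise power `β^t`, `0 ≤ t ≤ 1`, of a kernel of hyperbolic type
is again a kernel of hyperbolic type. -/
theorem power_of_hyperbolic_kernel {X : Type*} (β : X → X → ℝ)
    (hβ : IsHypKernel β) (t : ℝ) (ht0 : 0 ≤ t) (ht1 : t ≤ 1) :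
    IsHypKernel (fun x y => (β x y) ^ t) := by
  refine ⟨fun x y => by simp only [hβ.1 x y], fun x y => Real.rpow_nonneg (hβ.2.1 x y) t,
    fun x => by simp [hβ.2.2.1 x], fun n x₀ x c => ?_⟩
  have h := (hβ.posSemidef x₀ x).sum_mul_one_sub_one_sub_rpow_nonneg (fun i j => ?_) ht0 ht1
    (fun i => c i * β (x i) x₀ ^ t)
  · rw [sq, Finset.sum_mul_sum, ← sub_nonneg, ← Finset.sum_sub_distrib]
    convert h using 1
    refine Finset.sum_congr rfl fun i _ => ?_
    rw [← Finset.sum_sub_distrib]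
    refine Finset.sum_congr rfl fun j _ => ?_
    have hi := hβ.pos (x i) x₀
    have hj := hβ.pos (x j) x₀
    have hi' := Real.rpow_pos_of_pos hi t
    have hj' := Real.rpow_pos_of_pos hj t
    rw [Matrix.of_apply, sub_sub_cancel, Real.div_rpow (hβ.2.1 _ _) (mul_pos hi hj).le,
      Real.mul_rpow hi.le hj.le]
    field_simp
  · have hij := mul_pos (hβ.pos (x i) x₀) (hβ.pos (x j) x₀)
    have h1 := div_pos (hβ.pos (x i) (x j)) hij
    have h2 := (div_lt_iff₀ hij).2 (hβ.lt_two_mul (x i) (x j) x₀)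
    rw [Matrix.of_apply, abs_lt]
    constructor <;> linarith
end

section
/- Let H be a real Hilbert space and let f be any map from a non-empty set X to the hyperboloid ℋ(H). Then the function β defined on X × X by β(x,y) = B(f(x), f(y)) (equivalently, β(x,y) = cosh d(f(x), f(y))) is a kernel of hyperbolic type on X. -/
open scoped RealInnerProductSpace

variable (H : Type*) [NormedAddCommGroup H] [InnerProductSpace ℝ H]

theorem minkB_comm {E : Type*} [NormedAddCommGroup E] [InnerProductSpace ℝ E] (v w : ℝ × E) :
    minkB E v w = minkB E w v := by
  simp only [minkB, real_inner_comm, mul_comm]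

theorem minkB_sum_smul_left {E : Type*} [NormedAddCommGroup E] [InnerProductSpace ℝ E]
    {ι : Type*} (s : Finset ι) (c : ι → ℝ) (v : ι → ℝ × E) (w : ℝ × E) :
    minkB E (∑ i ∈ s, c i • v i) w = ∑ i ∈ s, c i * minkB E (v i) w := by
  simp only [minkB, Prod.fst_sum, Prod.snd_sum, Prod.smul_fst, Prod.smul_snd, sum_inner,
    real_inner_smul_left, Finset.sum_mul, smul_eq_mul, mul_sub, Finset.sum_sub_distrib, mul_assoc]

theorem minkB_sum_smul_self {E : Type*} [NormedAddCommGroup E] [InnerProductSpace ℝ E]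
    {ι : Type*} (s : Finset ι) (c : ι → ℝ) (v : ι → ℝ × E) :
    minkB E (∑ i ∈ s, c i • v i) (∑ i ∈ s, c i • v i) =
      ∑ i ∈ s, ∑ j ∈ s, c i * c j * minkB E (v i) (v j) := by
  rw [minkB_sum_smul_left]
  refine Finset.sum_congr rfl fun i _ => ?_
  rw [minkB_comm, minkB_sum_smul_left, Finset.mul_sum]
  refine Finset.sum_congr rfl fun j _ => ?_
  rw [minkB_comm (v j), mul_assoc]

/-- The reversed Cauchy–Schwarz inequality for the Minkowski form. -/
theorem minkB_self_le_sq {E : Type*} [NormedAddCommGroup E] [InnerProductSpace ℝ E]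
    (v : ℝ × E) {w : ℝ × E} (hw : minkB E w w = 1) : minkB E v v ≤ minkB E v w ^ 2 := by
  obtain ⟨s, h⟩ := v
  obtain ⟨t, k⟩ := w
  simp only [minkB] at hw ⊢
  have hcs := real_inner_mul_inner_self_le h k
  have hh : 0 ≤ ⟪h, h⟫ := real_inner_self_nonneg
  rcases (real_inner_self_nonneg (x := k)).eq_or_lt' with hk | hk
  · have hk0 : k = 0 := inner_self_eq_zero.mp hk
    subst hk0
    simp only [inner_zero_right, sub_zero] at hw ⊢
    nlinarith [congrArg (s ^ 2 * ·) hw]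
  · generalize ⟪h, k⟫ = p at *
    generalize ⟪h, h⟫ = a at *
    generalize ⟪k, k⟫ = b at *
    have ht : t ^ 2 = 1 + b := by linarith
    have key : b * ((s * t - p) ^ 2 - (s * s - a)) = (s * b - t * p) ^ 2 + (a * b - p * p) := by
      linear_combination (s ^ 2 * b - p ^ 2) * ht
    have := nonneg_of_mul_nonneg_right (key ▸ add_nonneg (sq_nonneg _) (sub_nonneg.2 hcs)) hk
    linarith

theorem minkB_nonneg_of_mem_Hyp {E : Type*} [NormedAddCommGroup E] [InnerProductSpace ℝ E]
    {v w : ℝ × E} (hv : v ∈ Hyp E) (hw : w ∈ Hyp E) : 0 ≤ minkB E v w := by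
  have norm_le {u : ℝ × E} (hu : u ∈ Hyp E) : ‖u.2‖ ≤ u.1 := by
    have h := hu.1
    simp only [minkB, real_inner_self_eq_norm_sq] at h
    exact le_of_abs_le (abs_le_of_sq_le_sq (by linarith) hu.2.le)
  exact sub_nonneg.2 <| (real_inner_le_norm _ _).trans <|
    mul_le_mul (norm_le hv) (norm_le hw) (norm_nonneg _) hv.2.le

/-- for any map `f` from a non-empty set `X` to the hyperboloid,
`β (x, y) = B (f x) (f y)` is a kernel of hyperbolic type. -/
theorem kernel_of_map_to_hyperboloid {X : Type*} [Nonempty X]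
    (H : Type*) [NormedAddCommGroup H] [InnerProductSpace ℝ H] [CompleteSpace H]
    (f : X → ℝ × H) (hf : ∀ x, f x ∈ Hyp H) :
    IsHypKernel (fun x y => minkB H (f x) (f y)) := by
  refine ⟨fun x y => minkB_comm _ _, fun x y => minkB_nonneg_of_mem_Hyp (hf x) (hf y),
    fun x => (hf x).1, fun n x₀ x c => ?_⟩
  rw [← minkB_sum_smul_self Finset.univ c fun i => f (x i),
    ← minkB_sum_smul_left Finset.univ c fun i => f (x i)]
  exact minkB_self_le_sq _ (hf x₀).1
end

section
/- (Reverse Schwarz inequality for Minkowski forms.) Let H be a real Hilbert space and let B be the Minkowski form on ℝ × H. For every v ∈ ℝ × H and every v₀ ∈ ℝ × H with B(v₀, v₀) = 1, one has B(v, v) ≤ B(v, v₀)². -/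
open scoped RealInnerProductSpace

variable (H : Type*) [NormedAddCommGroup H] [InnerProductSpace ℝ H]

/-- reverse Schwarz inequality for the Minkowski form:
if `B v₀ v₀ = 1` then `B v v ≤ (B v v₀)²`. -/
theorem reverse_schwarz (H : Type*) [NormedAddCommGroup H] [InnerProductSpace ℝ H]
    (v v₀ : ℝ × H) (hv₀ : minkB H v₀ v₀ = 1) :
    minkB H v v ≤ (minkB H v v₀) ^ 2 := by
  simp only [minkB, real_inner_self_eq_norm_sq] at hv₀ ⊢
  have hcs : ⟪v.2, v₀.2⟫ ^ 2 ≤ ‖v.2‖ ^ 2 * ‖v₀.2‖ ^ 2 := by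
    rw [← mul_pow]
    exact sq_le_sq.2 ((abs_real_inner_le_norm _ _).trans (le_abs_self _))
  rcases eq_or_ne v₀.2 0 with h | h
  · simp only [h, inner_zero_right, norm_zero] at hv₀ ⊢
    nlinarith [sq_nonneg ‖v.2‖]
  · have hq : 0 < ‖v₀.2‖ ^ 2 := by positivity
    generalize ⟪v.2, v₀.2⟫ = a at *
    generalize ‖v₀.2‖ ^ 2 = q at *
    obtain rfl : q = v₀.1 * v₀.1 - 1 := by linarith
    refine le_of_mul_le_mul_left ?_ hq
    nlinarith [sq_nonneg (v.1 * (v₀.1 * v₀.1 - 1) - v₀.1 * a)]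
end

section
/- Let X be a non-empty set and let β : X × X → ℝ be a kernel of hyperbolic type. Suppose H₁ and H₂ are real Hilbert spaces and f₁ : X → ℋ(H₁), f₂ : X → ℋ(H₂) are maps with hyperbolically total images such that B₁(f₁(x), f₁(y)) = β(x,y) = B₂(f₂(x), f₂(y)) for all x,y ∈ X. Then there exists a unique bijection Φ : ℋ(H₁) → ℋ(H₂) satisfying B₂(Φ(u), Φ(v)) = B₁(u,v) for all u,v ∈ ℋ(H₁) (i.e. a unique isometry of the hyperbolic spaces) such that Φ ∘ f₁ = f₂. -/
open scoped RealInnerProductSpace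

variable (H : Type*) [NormedAddCommGroup H] [InnerProductSpace ℝ H]

theorem minkB_comm_s4 (v w : ℝ × H) : minkB H v w = minkB H w v := by
  simp only [minkB, real_inner_comm, mul_comm]

/-- The Minkowski form as a bundled bilinear form. -/
noncomputable def minkForm : LinearMap.BilinForm ℝ (ℝ × H) :=
  LinearMap.mk₂ ℝ (minkB H)
    (fun v v' w => by simp only [minkB, Prod.fst_add, Prod.snd_add, inner_add_left]; ring)
    (fun c v w => by
      simp only [minkB, Prod.smul_fst, Prod.smul_snd, real_inner_smul_left, smul_eq_mul]; ring)
    (fun v w w' => by simp only [minkB, Prod.fst_add, Prod.snd_add, inner_add_right]; ring)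
    (fun c v w => by
      simp only [minkB, Prod.smul_fst, Prod.smul_snd, real_inner_smul_right, smul_eq_mul]; ring)

@[simp]
theorem minkForm_apply (v w : ℝ × H) : minkForm H v w = minkB H v w := rfl

theorem Continuous.minkB {Y : Type*} [TopologicalSpace Y] {f g : Y → ℝ × H}
    (hf : Continuous f) (hg : Continuous g) : Continuous fun y => minkB H (f y) (g y) := by
  unfold _root_.minkB
  fun_prop

theorem eq_zero_of_minkB_eq_zero {v : ℝ × H} (h : ∀ w, minkB H v w = 0) : v = 0 := by
  have h₁ := h (1, 0)
  have h₂ := h (0, v.2)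
  simp only [minkB, mul_one, inner_zero_right, sub_zero, mul_zero, zero_sub, neg_eq_zero,
    inner_self_eq_zero] at h₁ h₂
  exact Prod.ext h₁ h₂

/-- A vector is determined by its Minkowski products with a total set. -/
theorem HypTotal.ext_minkB {S : Set (ℝ × H)} (hS : HypTotal H S) {v w : ℝ × H}
    (h : ∀ s ∈ S, minkB H v s = minkB H w s) : v = w := by
  rw [← sub_eq_zero]
  refine eq_zero_of_minkB_eq_zero H fun u => ?_
  have hle : (Submodule.span ℝ S).topologicalClosure ≤ LinearMap.ker (minkForm H (v - w)) := by
    refine Submodule.topologicalClosure_minimal _ (Submodule.span_le.2 fun s hs => ?_) ?_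
    · simp only [SetLike.mem_coe, LinearMap.mem_ker, map_sub, LinearMap.sub_apply, minkForm_apply]
      exact sub_eq_zero.2 (h s hs)
    · exact isClosed_singleton.preimage
        (Continuous.minkB H (continuous_const (y := v - w)) continuous_id)
  rw [hS] at hle
  exact hle (Submodule.mem_top (x := u))

theorem Hyp.fst_pos_iff {p v : ℝ × H} (hp : p ∈ Hyp H) (hv : minkB H v v = 1) :
    0 < v.1 ↔ 0 < minkB H v p := by
  obtain ⟨hp, hpos⟩ := hp
  have hcs := abs_le.1 (abs_real_inner_le_norm v.2 p.2)
  simp only [minkB, real_inner_self_eq_norm_sq] at hp hv ⊢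
  have hb : ‖p.2‖ < p.1 := by nlinarith [norm_nonneg p.2]
  have hh : ‖v.2‖ < |v.1| := by
    refine lt_of_pow_lt_pow_left₀ 2 (abs_nonneg _) ?_
    rw [sq_abs]
    linarith
  have hmul : ‖v.2‖ * ‖p.2‖ < |v.1| * p.1 :=
    mul_lt_mul'' hh hb (norm_nonneg _) (norm_nonneg _)
  constructor
  · intro h
    rw [abs_of_pos h] at hmul
    linarith
  · intro h
    by_contra! hle
    rw [abs_of_nonpos hle] at hmul
    linarith

theorem Hyp.one_le_fst {p : ℝ × H} (hp : p ∈ Hyp H) : 1 ≤ p.1 := by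
  obtain ⟨hp, hpos⟩ := hp
  simp only [minkB, real_inner_self_eq_norm_sq] at hp
  nlinarith [sq_nonneg ‖p.2‖]

theorem prod_norm_sq_le {E : Type*} [NormedAddCommGroup E] {v : ℝ × E} {C : ℝ} (h₁ : v.1 ^ 2 ≤ C) (h₂ : ‖v.2‖ ^ 2 ≤ C) :
    ‖v‖ ^ 2 ≤ C := by
  rw [Prod.norm_def]
  rcases max_choice ‖v.1‖ ‖v.2‖ with h | h <;> rw [h]
  · rwa [Real.norm_eq_abs, sq_abs]
  · exact h₂

/-- The Euclidean form obtained by flipping the sign of the Minkowski form on the complement of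
`p ∈ Hyp H` dominates the norm. -/
theorem Hyp.norm_sq_le {p : ℝ × H} (hp : p ∈ Hyp H) (v : ℝ × H) :
    ‖v‖ ^ 2 ≤ 6 * p.1 ^ 2 * (2 * minkB H v p ^ 2 - minkB H v v) := by
  have ha := Hyp.one_le_fst H hp
  obtain ⟨hp, -⟩ := hp
  have hcs := sq_le_sq' (abs_le.1 (abs_real_inner_le_norm v.2 p.2)).1
    (abs_le.1 (abs_real_inner_le_norm v.2 p.2)).2
  simp only [minkB, real_inner_self_eq_norm_sq] at hp ⊢
  generalize (⟪v.2, p.2⟫ : ℝ) = t at *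
  have hq : p.1 * v.1 = (v.1 * p.1 - t) + t := by ring
  generalize v.1 * p.1 - t = q at *
  have hA : 1 ≤ p.1 ^ 2 := by nlinarith
  have hb : ‖p.2‖ ^ 2 = p.1 ^ 2 - 1 := by linarith
  rw [mul_pow, hb] at hcs
  have hs : p.1 ^ 2 * v.1 ^ 2 = q ^ 2 + 2 * q * t + t ^ 2 := by
    rw [← mul_pow, hq]; ring
  generalize hN : ‖v.2‖ ^ 2 = N at *
  have hN0 : 0 ≤ N := hN ▸ sq_nonneg _
  set A := p.1 ^ 2 with hAdef
  set s := v.1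
  have hQ : q ^ 2 ≤ 2 * q ^ 2 - (s * s - N) := by
    have h0 : A * (s ^ 2 - N) ≤ A * q ^ 2 := by
      rcases eq_or_lt_of_le hA with h | h
      · rw [← h] at hcs hs ⊢
        have ht : t = 0 := by nlinarith
        subst ht
        nlinarith
      · have : 0 ≤ ((A - 1) * q - t) ^ 2 := sq_nonneg _
        have h1 : 0 < A - 1 := by linarith
        have : (A - 1) * (A * (s ^ 2 - N)) ≤ (A - 1) * (A * q ^ 2) := by nlinarith
        exact le_of_mul_le_mul_left this h1
    have := le_of_mul_le_mul_left h0 (by linarith)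
    linarith
  generalize hQd : 2 * q ^ 2 - (s * s - N) = Q at *
  have hyoung : 2 * A * (2 * q * t) ≤ 4 * A ^ 2 * q ^ 2 + t ^ 2 := by
    nlinarith [sq_nonneg (2 * A * q - t)]
  have hNQ : N ≤ 4 * A * Q := by
    have ht : (1 + 2 * A) * t ^ 2 ≤ (1 + 2 * A) * (N * (A - 1)) := by gcongr
    have hsA := congrArg (2 * A * ·) hs
    have hsN := congrArg (2 * A ^ 2 * ·) hQd
    have hqA : 2 * A * q ^ 2 ≤ 2 * A * Q := by gcongr
    have h0 : (A + 1) * N ≤ (A + 1) * (2 * A * Q) := by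
      linarith
    have := le_of_mul_le_mul_left h0 (by linarith)
    nlinarith [mul_nonneg (zero_le_one.trans hA) ((sq_nonneg q).trans hQ)]
  have hQ0 : 0 ≤ Q := le_trans (sq_nonneg q) hQ
  refine prod_norm_sq_le ?_ ?_
  · change s ^ 2 ≤ _
    nlinarith
  · rw [hN]
    nlinarith

theorem Hyp.le_norm_sq {p : ℝ × H} (hp : p ∈ Hyp H) (v : ℝ × H) :
    2 * minkB H v p ^ 2 - minkB H v v ≤ 9 * p.1 ^ 2 * ‖v‖ ^ 2 := by
  have ha := Hyp.one_le_fst H hp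
  obtain ⟨hp, -⟩ := hp
  have hcs := sq_le_sq' (abs_le.1 (abs_real_inner_le_norm v.2 p.2)).1
    (abs_le.1 (abs_real_inner_le_norm v.2 p.2)).2
  have h₁ : v.1 ^ 2 ≤ ‖v‖ ^ 2 := by
    rw [← sq_abs]
    exact pow_le_pow_left₀ (abs_nonneg _) (norm_fst_le v) 2
  have h₂ : ‖v.2‖ ^ 2 ≤ ‖v‖ ^ 2 := pow_le_pow_left₀ (norm_nonneg _) (norm_snd_le v) 2
  simp only [minkB, real_inner_self_eq_norm_sq] at hp ⊢
  generalize (⟪v.2, p.2⟫ : ℝ) = t at *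
  have hA : 1 ≤ p.1 ^ 2 := by nlinarith
  have hb : ‖p.2‖ ^ 2 = p.1 ^ 2 - 1 := by linarith
  rw [mul_pow, hb] at hcs
  have ht : t ^ 2 ≤ p.1 ^ 2 * ‖v‖ ^ 2 := by nlinarith [sq_nonneg ‖v‖]
  have hs : v.1 ^ 2 * p.1 ^ 2 ≤ p.1 ^ 2 * ‖v‖ ^ 2 := by nlinarith
  have hN : ‖v‖ ^ 2 ≤ p.1 ^ 2 * ‖v‖ ^ 2 := by nlinarith [sq_nonneg ‖v‖]
  nlinarith [sq_nonneg (v.1 * p.1 + t), sq_nonneg v.1]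

theorem HypTotal.denseRange {X : Type*} {f : X → ℝ × H} (hf : HypTotal H (Set.range f)) :
    DenseRange (Finsupp.linearCombination ℝ f) := by
  rw [DenseRange, ← LinearMap.coe_range, Finsupp.range_linearCombination]
  exact Submodule.dense_iff_topologicalClosure_eq_top.2 hf

section Realization

variable {X H₁ H₂ : Type*}
  [NormedAddCommGroup H₁] [InnerProductSpace ℝ H₁]
  [NormedAddCommGroup H₂] [InnerProductSpace ℝ H₂]
  {f₁ : X → ℝ × H₁} {f₂ : X → ℝ × H₂}

theorem minkB_linearCombination
    (h : ∀ x y, minkB H₁ (f₁ x) (f₁ y) = minkB H₂ (f₂ x) (f₂ y)) (c d : X →₀ ℝ) :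
    minkB H₁ (Finsupp.linearCombination ℝ f₁ c) (Finsupp.linearCombination ℝ f₁ d) =
      minkB H₂ (Finsupp.linearCombination ℝ f₂ c) (Finsupp.linearCombination ℝ f₂ d) := by
  have key : (minkForm H₁).compl₁₂ (Finsupp.linearCombination ℝ f₁)
      (Finsupp.linearCombination ℝ f₁) = (minkForm H₂).compl₁₂ (Finsupp.linearCombination ℝ f₂)
      (Finsupp.linearCombination ℝ f₂) := by
    ext x y
    simpa using h x y
  exact LinearMap.congr_fun₂ key c d

theorem exists_norm_linearCombination_le [Nonempty X]
    (hf₁ : ∀ x, f₁ x ∈ Hyp H₁) (hf₂ : ∀ x, f₂ x ∈ Hyp H₂)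
    (h : ∀ x y, minkB H₁ (f₁ x) (f₁ y) = minkB H₂ (f₂ x) (f₂ y)) :
    ∃ C : ℝ, ∀ c : X →₀ ℝ,
      ‖Finsupp.linearCombination ℝ f₂ c‖ ≤ C * ‖Finsupp.linearCombination ℝ f₁ c‖ := by
  obtain ⟨x₀⟩ := ‹Nonempty X›
  have h₁ := Hyp.one_le_fst H₁ (hf₁ x₀)
  have h₂ := Hyp.one_le_fst H₂ (hf₂ x₀)
  refine ⟨8 * (f₁ x₀).1 * (f₂ x₀).1, fun c => ?_⟩
  refine (sq_le_sq₀ (norm_nonneg _) (by positivity)).1 ?_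
  have e₁ := minkB_linearCombination h c c
  have e₂ := minkB_linearCombination h c (Finsupp.single x₀ 1)
  simp only [Finsupp.linearCombination_single, one_smul] at e₂
  have hle := Hyp.le_norm_sq H₁ (hf₁ x₀) (Finsupp.linearCombination ℝ f₁ c)
  rw [e₁, e₂] at hle
  calc _ ≤ _ := Hyp.norm_sq_le H₂ (hf₂ x₀) (Finsupp.linearCombination ℝ f₂ c)
    _ ≤ 6 * (f₂ x₀).1 ^ 2 *
        (9 * (f₁ x₀).1 ^ 2 * ‖Finsupp.linearCombination ℝ f₁ c‖ ^ 2) := by gcongr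
    _ ≤ _ := by
      have : 0 ≤ ((f₁ x₀).1 * (f₂ x₀).1 * ‖Finsupp.linearCombination ℝ f₁ c‖) ^ 2 := sq_nonneg _
      nlinarith

/-- Two realizations of the same kernel, the first of them total, are related by a continuous
linear map preserving the Minkowski forms. -/
theorem exists_minkB_preserving_map [Nonempty X] [CompleteSpace H₂]
    (hf₁ : ∀ x, f₁ x ∈ Hyp H₁) (hf₂ : ∀ x, f₂ x ∈ Hyp H₂)
    (htot₁ : HypTotal H₁ (Set.range f₁))
    (h : ∀ x y, minkB H₁ (f₁ x) (f₁ y) = minkB H₂ (f₂ x) (f₂ y)) :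
    ∃ T : (ℝ × H₁) →L[ℝ] (ℝ × H₂), (∀ x, T (f₁ x) = f₂ x) ∧
      (∀ v w, minkB H₂ (T v) (T w) = minkB H₁ v w) ∧ ∀ v ∈ Hyp H₁, T v ∈ Hyp H₂ := by
  have hd := htot₁.denseRange
  set T := (Finsupp.linearCombination ℝ f₂).extendOfNorm (Finsupp.linearCombination ℝ f₁)
  have hT : ∀ c, T (Finsupp.linearCombination ℝ f₁ c) = Finsupp.linearCombination ℝ f₂ c :=
    LinearMap.extendOfNorm_eq hd (exists_norm_linearCombination_le hf₁ hf₂ h)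
  have hTf : ∀ x, T (f₁ x) = f₂ x := fun x => by simpa using hT (Finsupp.single x 1)
  have hTB : ∀ v w, minkB H₂ (T v) (T w) = minkB H₁ v w := fun v w => by
    refine hd.induction_on₂ (p := fun v w => minkB H₂ (T v) (T w) = minkB H₁ v w) ?_ ?_ v w
    · exact isClosed_eq
        (Continuous.minkB H₂ (T.continuous.comp continuous_fst) (T.continuous.comp continuous_snd))
        (Continuous.minkB H₁ continuous_fst continuous_snd)
    · intro c d
      rw [hT, hT, minkB_linearCombination h]
  refine ⟨T, hTf, hTB, fun v hv => ?_⟩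
  obtain ⟨x₀⟩ := ‹Nonempty X›
  have hTv : minkB H₂ (T v) (T v) = 1 := (hTB v v).trans hv.1
  refine ⟨hTv, (Hyp.fst_pos_iff H₂ (hf₂ x₀) hTv).2 ?_⟩
  rw [← hTf x₀, hTB]
  exact (Hyp.fst_pos_iff H₁ (hf₁ x₀) hv.1).1 hv.2

end Realization

/-- uniqueness, up to a unique isometry, of the realization of a kernel of
hyperbolic type by a map to a hyperboloid with hyperbolically total image. -/
theorem hyperbolic_kernel_realization_unique {X : Type*} [Nonempty X]
    (β : X → X → ℝ) (hβ : IsHypKernel β)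
    (H₁ : Type*) [NormedAddCommGroup H₁] [InnerProductSpace ℝ H₁] [CompleteSpace H₁]
    (H₂ : Type*) [NormedAddCommGroup H₂] [InnerProductSpace ℝ H₂] [CompleteSpace H₂]
    (f₁ : X → ℝ × H₁) (f₂ : X → ℝ × H₂)
    (hf₁ : ∀ x, f₁ x ∈ Hyp H₁) (hf₂ : ∀ x, f₂ x ∈ Hyp H₂)
    (htot₁ : HypTotal H₁ (Set.range f₁)) (htot₂ : HypTotal H₂ (Set.range f₂))
    (hβ₁ : ∀ x y, minkB H₁ (f₁ x) (f₁ y) = β x y)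
    (hβ₂ : ∀ x y, minkB H₂ (f₂ x) (f₂ y) = β x y) :
    ∃! Φ : Hyp H₁ → Hyp H₂,
      Function.Bijective Φ ∧
      (∀ u v : Hyp H₁, minkB H₂ (Φ u : ℝ × H₂) (Φ v : ℝ × H₂) = minkB H₁ (u : ℝ × H₁) (v : ℝ × H₁)) ∧
      (∀ x : X, (Φ ⟨f₁ x, hf₁ x⟩ : ℝ × H₂) = f₂ x) := by
  have h : ∀ x y, minkB H₁ (f₁ x) (f₁ y) = minkB H₂ (f₂ x) (f₂ y) := fun x y =>
    (hβ₁ x y).trans (hβ₂ x y).symm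
  obtain ⟨T, hTf, hTB, hT⟩ := exists_minkB_preserving_map hf₁ hf₂ htot₁ h
  obtain ⟨S, hSf, hSB, hS⟩ := exists_minkB_preserving_map hf₂ hf₁ htot₂ fun x y => (h x y).symm
  have hST : ∀ v, S (T v) = v := fun v => htot₁.ext_minkB H₁ <| by
    rintro _ ⟨x, rfl⟩
    rw [← hTB v, hTf, ← hSB, hSf]
  have hTS : ∀ v, T (S v) = v := fun v => htot₂.ext_minkB H₂ <| by
    rintro _ ⟨x, rfl⟩
    rw [← hSB v, hSf, ← hTB, hTf]
  refine ⟨fun u => ⟨T u, hT u u.2⟩, ⟨?_, fun u v => hTB u v, hTf⟩, ?_⟩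
  · exact Function.bijective_iff_has_inverse.2 ⟨fun u => ⟨S u, hS u u.2⟩,
      fun u => Subtype.ext (hST u), fun u => Subtype.ext (hTS u)⟩
  · rintro Ψ ⟨-, hΨB, hΨf⟩
    refine funext fun u => Subtype.ext <| htot₂.ext_minkB H₂ ?_
    rintro _ ⟨x, rfl⟩
    rw [← hΨf x, hΨB, hΨf, ← hTf x, hTB]
end

section
/- Let X be a set and let ψ : X × X → ℝ be a kernel of conditionally negative type. Then the kernel β := 1 + ψ, i.e. (x,y) ↦ 1 + ψ(x,y), is a kernel of hyperbolic type on X. -/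
open scoped RealInnerProductSpace

variable (H : Type*) [NormedAddCommGroup H] [InnerProductSpace ℝ H]

/-- if `ψ` is a kernel of conditionally negative type, then `1 + ψ` is a
kernel of hyperbolic type. -/
theorem one_add_cnd_is_hyperbolic {X : Type*} (ψ : X → X → ℝ)
    (hψ : IsCNDKernel ψ) :
    IsHypKernel (fun x y => 1 + ψ x y) := by
  obtain ⟨hsymm, hdiag, hneg⟩ := hψ
  refine ⟨fun x y => by simp only [hsymm x y], fun x y => ?_, fun x => by simp [hdiag], ?_⟩
  · have h := hneg 2 ![x, y] ![1, -1] (by simp)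
    simp only [Fin.sum_univ_two, Matrix.cons_val_zero, Matrix.cons_val_one, hdiag,
      hsymm y x] at h
    linarith
  · intro n x₀ x c
    have h := hneg (n + 1) (Fin.cons x₀ x) (Fin.cons (-∑ i, c i) c)
      (by simp [Fin.sum_univ_succ])
    simp only [Fin.sum_univ_succ, Fin.cons_zero, Fin.cons_succ, hdiag, hsymm x₀,
      Finset.sum_add_distrib] at h
    have hrow : ∑ i, -(∑ k, c k) * c i * ψ (x i) x₀ =
        -(∑ k, c k) * ∑ i, c i * ψ (x i) x₀ := by
      simp only [Finset.mul_sum, mul_assoc]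
    have hcol : ∑ i, c i * -(∑ k, c k) * ψ (x i) x₀ =
        -(∑ k, c k) * ∑ i, c i * ψ (x i) x₀ := by
      rw [← hrow]
      exact Finset.sum_congr rfl fun i _ => by ring
    have hone : ∑ i, ∑ j, c i * c j = (∑ k, c k) ^ 2 := by
      rw [sq, Finset.sum_mul_sum]
    simp only [mul_add, mul_one, Finset.sum_add_distrib, hone]
    rw [hrow, hcol] at h
    nlinarith [sq_nonneg (∑ i, c i * ψ (x i) x₀)]
end

section
/- Let X be a non-empty set, β : X × X → ℝ an unbounded kernel of hyperbolic type, H a real Hilbert space, and f : X → ℋ(H) a map with hyperbolically total image such that B(f(x), f(y)) = β(x,y) for all x,y ∈ X. Then the following are equivalent: (1) f(X) is contained in a horosphere, i.e. there exists a nonzero vector ξ ∈ ℝ × H with B(ξ,ξ) = 0 and a constant c ∈ ℝ such that B(f(x), ξ) = c for all x ∈ X; (2) the kernel β − 1, i.e. (x,y) ↦ β(x,y) − 1, is of conditionally negative type. -/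
open scoped RealInnerProductSpace

variable (H : Type*) [NormedAddCommGroup H] [InnerProductSpace ℝ H]

section Minkowski

variable {H}

theorem minkB_sum_sum {ι : Type*} (s : Finset ι) (c : ι → ℝ) (v : ι → ℝ × H) :
    minkB H (∑ i ∈ s, c i • v i) (∑ i ∈ s, c i • v i) =
      ∑ i ∈ s, ∑ j ∈ s, c i * c j * minkB H (v i) (v j) := by
  simp only [minkB, Prod.fst_sum, Prod.snd_sum, Prod.smul_fst, Prod.smul_snd, sum_inner,
    inner_sum, real_inner_smul_left, real_inner_smul_right, Finset.sum_mul_sum, smul_eq_mul,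
    ← Finset.sum_sub_distrib]
  refine Finset.sum_congr rfl fun i _ => Finset.sum_congr rfl fun j _ => ?_
  rw [real_inner_comm (v i).2]
  ring

theorem minkB_sum_left {ι : Type*} (s : Finset ι) (c : ι → ℝ) (v : ι → ℝ × H) (w : ℝ × H) :
    minkB H (∑ i ∈ s, c i • v i) w = ∑ i ∈ s, c i * minkB H (v i) w := by
  simp only [minkB, Prod.fst_sum, Prod.snd_sum, Prod.smul_fst, Prod.smul_snd, sum_inner,
    real_inner_smul_left, Finset.sum_mul, smul_eq_mul, ← Finset.sum_sub_distrib]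
  refine Finset.sum_congr rfl fun i _ => ?_
  ring

theorem continuous_minkB_self : Continuous fun v : ℝ × H => minkB H v v := by
  unfold minkB
  fun_prop

/-- The Minkowski form is negative semidefinite on the orthogonal of a nonzero null vector. -/
theorem minkB_self_nonpos_of_orthogonal_null {v ξ : ℝ × H} (hξ : ξ ≠ 0)
    (hnull : minkB H ξ ξ = 0) (h : minkB H v ξ = 0) : minkB H v v ≤ 0 := by
  simp only [minkB, real_inner_self_eq_norm_sq] at *
  have hpos : 0 < ‖ξ.2‖ := by
    rw [norm_pos_iff]
    intro h2
    refine hξ (Prod.ext ?_ h2)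
    simpa [h2] using hnull
  have hcs : (v.1 * ξ.1) ^ 2 ≤ (‖v.2‖ * ‖ξ.2‖) ^ 2 := by
    rw [sub_eq_zero.1 h, sq_le_sq, abs_of_nonneg (by positivity : 0 ≤ ‖v.2‖ * ‖ξ.2‖)]
    exact abs_real_inner_le_norm _ _
  have hsq : ξ.1 ^ 2 = ‖ξ.2‖ ^ 2 := by linarith
  rw [mul_pow, mul_pow, hsq] at hcs
  nlinarith [le_of_mul_le_mul_right hcs (by positivity)]

/-- The orthogonal of a spacelike vector contains a timelike vector. -/
theorem exists_orthogonal_minkB_self_pos {ξ : ℝ × H} (h : minkB H ξ ξ < 0) :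
    ∃ v, minkB H v ξ = 0 ∧ 0 < minkB H v v := by
  refine ⟨(‖ξ.2‖ ^ 2, ξ.1 • ξ.2), ?_, ?_⟩ <;>
    simp only [minkB, real_inner_smul_left,
      real_inner_self_eq_norm_sq, norm_smul, mul_pow, Real.norm_eq_abs, sq_abs] at *
  · ring
  · have : 0 < ‖ξ.2‖ ^ 2 := by nlinarith [sq_nonneg ξ.1]
    nlinarith [mul_pos this (sub_pos.2 (sub_neg.1 h))]

theorem norm_snd_lt_fst_of_mem_Hyp {v : ℝ × H} (hv : v ∈ Hyp H) : ‖v.2‖ < v.1 := by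
  obtain ⟨h1, h2⟩ := hv
  rw [minkB, real_inner_self_eq_norm_sq] at h1
  exact lt_of_pow_lt_pow_left₀ 2 h2.le (by linarith)

theorem minkB_le_of_mem_Hyp {v w : ℝ × H} (hv : v ∈ Hyp H) (hw : w ∈ Hyp H) :
    minkB H v w ≤ 2 * (v.1 * w.1) := by
  have h1 := neg_le_of_abs_le (abs_real_inner_le_norm v.2 w.2)
  have h2 := mul_le_mul (norm_snd_lt_fst_of_mem_Hyp hv).le (norm_snd_lt_fst_of_mem_Hyp hw).le
    (norm_nonneg _) hv.2.le
  unfold minkB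
  linarith

/-- Points of the hyperboloid on a level set of a timelike vector have bounded height. -/
theorem fst_le_of_minkB_self_pos {v ξ : ℝ × H} (hv : v ∈ Hyp H) (hξ : 0 < minkB H ξ ξ) :
    v.1 ≤ |minkB H v ξ| / (|ξ.1| - ‖ξ.2‖) := by
  have hgap : ‖ξ.2‖ < |ξ.1| := by
    rw [minkB, real_inner_self_eq_norm_sq] at hξ
    refine lt_of_pow_lt_pow_left₀ 2 (abs_nonneg _) ?_
    rw [sq_abs]
    linarith
  rw [le_div_iff₀ (sub_pos.2 hgap)]
  have h1 : |v.1 * ξ.1| - |⟪v.2, ξ.2⟫| ≤ |minkB H v ξ| := abs_sub_abs_le_abs_sub _ _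
  rw [abs_mul, abs_of_pos hv.2] at h1
  have h2 := abs_real_inner_le_norm v.2 ξ.2
  have h3 := mul_le_mul_of_nonneg_right (norm_snd_lt_fst_of_mem_Hyp hv).le (norm_nonneg ξ.2)
  linarith

/-- Riesz representation for the Minkowski form. -/
theorem exists_minkB_eq [CompleteSpace H] (φ : StrongDual ℝ (ℝ × H)) :
    ∃ ξ, ∀ v, minkB H v ξ = φ v := by
  refine ⟨(φ (1, 0),
    -(InnerProductSpace.toDual ℝ H).symm (φ.comp (ContinuousLinearMap.inr ℝ ℝ H))), fun v => ?_⟩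
  have hv : v = v.1 • ((1 : ℝ), (0 : H)) + (0, v.2) := by ext <;> simp
  rw [minkB, inner_neg_right, real_inner_comm, InnerProductSpace.toDual_symm_apply]
  conv_rhs => rw [hv, map_add, map_smul]
  simp

end Minkowski

theorem exists_dual_eq_zero_of_isClosed {E : Type*} [NormedAddCommGroup E] [NormedSpace ℝ E]
    (W : Submodule ℝ E) (hW : IsClosed (W : Set E)) {x : E} (hx : x ∉ W) :
    ∃ φ : StrongDual ℝ E, (∀ w ∈ W, φ w = 0) ∧ φ x ≠ 0 := by
  obtain ⟨φ, u, hlt, hux⟩ := geometric_hahn_banach_closed_point W.convex hW hx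
  have h0 : 0 < u := by simpa using hlt 0 W.zero_mem
  refine ⟨φ, fun w hw => ?_, (h0.trans hux).ne'⟩
  by_contra hne
  have := hlt ((u / φ w) • w) (W.smul_mem _ hw)
  rw [map_smul, smul_eq_mul, div_mul_cancel₀ _ hne] at this
  exact lt_irrefl _ this

theorem IsCNDKernel.finset_sum_nonpos {X : Type*} {ψ : X → X → ℝ} (hψ : IsCNDKernel ψ)
    (s : Finset X) (c : X → ℝ) (hc : ∑ i ∈ s, c i = 0) :
    ∑ i ∈ s, ∑ j ∈ s, c i * c j * ψ i j ≤ 0 := by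
  have key (g : X → ℝ) : ∑ k, g (s.equivFin.symm k) = ∑ i ∈ s, g i := by
    rw [Equiv.sum_comp s.equivFin.symm fun i : s => g i, Finset.sum_coe_sort]
  have := hψ.2.2 s.card (fun k => s.equivFin.symm k) (fun k => c (s.equivFin.symm k))
    ((key c).trans hc)
  rw [key fun i => ∑ l, c i * c (s.equivFin.symm l) * ψ i (s.equivFin.symm l)] at this
  simpa only [fun i => key fun j => c i * c j * ψ i j] using this

theorem sum_sum_mul_sub_one {ι : Type*} (s : Finset ι) (c : ι → ℝ) (β : ι → ι → ℝ)
    (hc : ∑ i ∈ s, c i = 0) :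
    ∑ i ∈ s, ∑ j ∈ s, c i * c j * (β i j - 1) = ∑ i ∈ s, ∑ j ∈ s, c i * c j * β i j := by
  simp only [mul_sub, mul_one, Finset.sum_sub_distrib, ← Finset.mul_sum, hc, mul_zero, sub_zero]

/-- The linear combinations of values of `f` whose coefficients sum to zero. -/
noncomputable def affineDirection {X E : Type*} [AddCommGroup E] [Module ℝ E] (f : X → E) :
    Submodule ℝ E :=
  (LinearMap.ker (Finsupp.linearCombination ℝ fun _ : X => (1 : ℝ))).map
    (Finsupp.linearCombination ℝ f)

theorem sub_mem_affineDirection {X E : Type*} [AddCommGroup E] [Module ℝ E] (f : X → E)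
    (x y : X) : f x - f y ∈ affineDirection f :=
  ⟨Finsupp.single x 1 - Finsupp.single y 1, by simp, by simp⟩

theorem minkB_self_nonpos_of_mem_affineDirection {X : Type*} {H : Type*} [NormedAddCommGroup H]
    [InnerProductSpace ℝ H] {f : X → ℝ × H}
    (h : IsCNDKernel fun x y => minkB H (f x) (f y) - 1) {v : ℝ × H}
    (hv : v ∈ affineDirection f) : minkB H v v ≤ 0 := by
  obtain ⟨c, hc, rfl⟩ := hv
  have hsum : ∑ i ∈ c.support, c i = 0 := by
    simpa [Finsupp.linearCombination_apply, Finsupp.sum] using hc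
  rw [Finsupp.linearCombination_apply, Finsupp.sum, minkB_sum_sum,
    ← sum_sum_mul_sub_one _ _ _ hsum]
  exact h.finset_sum_nonpos _ _ hsum

/-- If the values of `f` span a dense subspace and `φ` is constant and nonzero on them, the kernel
of `φ` lies in the closure of the direction of the affine span. -/
theorem mem_closure_affineDirection {X E : Type*} [NormedAddCommGroup E] [NormedSpace ℝ E]
    {f : X → E} (hf : (Submodule.span ℝ (Set.range f)).topologicalClosure = ⊤)
    {φ : StrongDual ℝ E} {x₀ : X} (hx₀ : φ (f x₀) ≠ 0) (hφ : ∀ x, φ (f x) = φ (f x₀))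
    {v : E} (hv : φ v = 0) : v ∈ closure (affineDirection f : Set E) := by
  let P : E →L[ℝ] E := .id ℝ E - (φ.smulRight ((φ (f x₀))⁻¹ • f x₀))
  have hP : Submodule.span ℝ (Set.range f) ≤ (affineDirection f).comap (P : E →ₗ[ℝ] E) := by
    rw [Submodule.span_le]
    rintro _ ⟨x, rfl⟩
    have : P (f x) = f x - f x₀ := by simp [P, hφ x, smul_smul, hx₀]
    simpa [this] using sub_mem_affineDirection f x x₀
  have hv' : v ∈ closure (Submodule.span ℝ (Set.range f) : Set E) := by
    rw [← Submodule.topologicalClosure_coe, hf]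
    trivial
  have := map_mem_closure P.continuous hv' (t := affineDirection f) fun w hw => hP hw
  simpa [P, hv] using this

/-- for an unbounded kernel of hyperbolic type realized by a map `f` with
hyperbolically total image, `f(X)` lies on a horosphere iff `β - 1` is of conditionally
negative type. -/
theorem horosphere_iff_cnd {X : Type*} [Nonempty X]
    (β : X → X → ℝ) (hβ : IsHypKernel β)
    (hub : ¬ ∃ M : ℝ, ∀ x y, β x y ≤ M)
    (H : Type*) [NormedAddCommGroup H] [InnerProductSpace ℝ H] [CompleteSpace H]
    (f : X → ℝ × H) (hf : ∀ x, f x ∈ Hyp H)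
    (htot : HypTotal H (Set.range f))
    (hβf : ∀ x y, minkB H (f x) (f y) = β x y) :
    (∃ (ξ : ℝ × H) (c : ℝ), ξ ≠ 0 ∧ minkB H ξ ξ = 0 ∧ ∀ x, minkB H (f x) ξ = c) ↔
      IsCNDKernel (fun x y => β x y - 1) := by
  constructor
  · rintro ⟨ξ, c, hξ, hnull, hc⟩
    refine ⟨fun x y => congrArg (· - 1) (hβ.1 x y), fun x => sub_eq_zero.2 (hβ.2.2.1 x),
      fun n x a ha => ?_⟩
    rw [sum_sum_mul_sub_one _ _ (fun i j => β (x i) (x j)) ha]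
    simp only [← hβf]
    rw [← minkB_sum_sum _ a fun i => f (x i)]
    refine minkB_self_nonpos_of_orthogonal_null hξ hnull ?_
    simp only [minkB_sum_left, hc, ← Finset.sum_mul, ha, zero_mul]
  · intro hcnd
    obtain ⟨x₀⟩ := ‹Nonempty X›
    obtain rfl : (fun x y => minkB H (f x) (f y)) = β := funext₂ hβf
    have hneg (v) (hv : v ∈ closure (affineDirection f : Set (ℝ × H))) : minkB H v v ≤ 0 :=
      closure_minimal (fun w hw => minkB_self_nonpos_of_mem_affineDirection hcnd hw)
        (isClosed_le continuous_minkB_self continuous_const) hv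
    obtain ⟨φ, hφ, hφ₀⟩ := exists_dual_eq_zero_of_isClosed
      (affineDirection f).topologicalClosure (Submodule.isClosed_topologicalClosure _)
      (x := f x₀) fun h => by linarith [hneg _ h, (hf x₀).1]
    have hconst (x) : φ (f x) = φ (f x₀) := sub_eq_zero.1 <| by
      rw [← map_sub]
      exact hφ _ (Submodule.le_topologicalClosure _ (sub_mem_affineDirection f x x₀))
    obtain ⟨ξ, hξ⟩ := exists_minkB_eq φ
    refine ⟨ξ, φ (f x₀), ?_, ?_, fun x => (hξ _).trans (hconst x)⟩
    · rintro rfl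
      exact hφ₀ (by simp [← hξ, minkB])
    · rcases lt_trichotomy (minkB H ξ ξ) 0 with h | h | h
      · obtain ⟨v, hv, hpos⟩ := exists_orthogonal_minkB_self_pos h
        exact absurd (hneg v (mem_closure_affineDirection htot hφ₀ hconst
          ((hξ v).symm.trans hv))) hpos.not_ge
      · exact h
      · have hT (x) : (f x).1 ≤ |φ (f x₀)| / (|ξ.1| - ‖ξ.2‖) := by
          simpa only [hξ, hconst] using fst_le_of_minkB_self_pos (hf x) h
        refine absurd ⟨2 * (|φ (f x₀)| / (|ξ.1| - ‖ξ.2‖)) ^ 2, fun x y =>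
          (minkB_le_of_mem_Hyp (hf x) (hf y)).trans ?_⟩ hub
        rw [sq]
        have := mul_le_mul (hT x) (hT y) (hf y).2.le ((hf x).2.le.trans (hT x))
        linarith
end

section
/- Let H be a separable infinite-dimensional real Hilbert space, 0 < t ≤ 1, and let ρ : O₊(B) → O₊(B) be a group homomorphism and f : ℋ(H) → ℋ(H) a ρ-equivariant map satisfying B(f(x), f(y)) = (B(x,y))^t for all x,y. Then for every g ∈ O₊(B), the translation length of ρ(g) equals t times the translation length of g: inf_{y ∈ ℋ(H)} d(ρ(g)·y, y) = t · inf_{x ∈ ℋ(H)} d(g·x, x). -/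
open scoped RealInnerProductSpace

variable (H : Type*) [NormedAddCommGroup H] [InnerProductSpace ℝ H]

namespace Hyp

variable {H}

theorem minkB_comm (v w : ℝ × H) : minkB H v w = minkB H w v := by
  simp only [minkB, real_inner_comm]
  ring

theorem minkB_add_left (u v w : ℝ × H) :
    minkB H (u + v) w = minkB H u w + minkB H v w := by
  simp only [minkB, Prod.fst_add, Prod.snd_add, inner_add_left]
  ring

theorem minkB_smul_left (r : ℝ) (v w : ℝ × H) : minkB H (r • v) w = r * minkB H v w := by
  simp only [minkB, Prod.smul_fst, Prod.smul_snd, real_inner_smul_left, smul_eq_mul]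
  ring

theorem minkB_add_right (u v w : ℝ × H) :
    minkB H u (v + w) = minkB H u v + minkB H u w := by
  rw [minkB_comm, minkB_add_left, minkB_comm v, minkB_comm w]

theorem minkB_smul_right (r : ℝ) (v w : ℝ × H) : minkB H v (r • w) = r * minkB H v w := by
  rw [minkB_comm, minkB_smul_left, minkB_comm]

theorem nonempty : (Hyp H).Nonempty := ⟨(1, 0), by simp [Hyp, minkB]⟩

theorem one_le_minkB {x y : ℝ × H} (hx : x ∈ Hyp H) (hy : y ∈ Hyp H) : 1 ≤ minkB H x y := by
  obtain ⟨hx, hx0⟩ := hx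
  obtain ⟨hy, hy0⟩ := hy
  simp only [minkB, real_inner_self_eq_norm_sq] at *
  have h := real_inner_le_norm x.2 y.2
  have hsq : (1 + ‖x.2‖ * ‖y.2‖) ^ 2 ≤ (x.1 * y.1) ^ 2 := by
    have e : (x.1 * y.1) ^ 2 = (1 + ‖x.2‖ ^ 2) * (1 + ‖y.2‖ ^ 2) := by
      rw [← eq_add_of_sub_eq hx, ← eq_add_of_sub_eq hy]
      ring
    nlinarith [sq_nonneg (‖x.2‖ - ‖y.2‖)]
  have := le_of_sq_le_sq hsq (by positivity)
  linarith

/-- The Minkowski form is negative semidefinite on the orthogonal of a point of `Hyp H`. -/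
theorem minkB_self_nonpos {y v : ℝ × H} (hy : y ∈ Hyp H) (hv : minkB H v y = 0) :
    minkB H v v ≤ 0 := by
  obtain ⟨hy, hy0⟩ := hy
  simp only [minkB, real_inner_self_eq_norm_sq] at *
  have h : (v.1 * y.1) ^ 2 ≤ (‖v.2‖ * ‖y.2‖) ^ 2 := by
    rw [eq_of_sub_eq_zero hv]
    exact sq_le_sq.2 ((abs_real_inner_le_norm _ _).trans (le_abs_self _))
  have hy2 : ‖y.2‖ ^ 2 = y.1 * y.1 - 1 := by linarith
  rw [mul_pow, mul_pow, hy2] at h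
  have : 0 < y.1 ^ 2 := by positivity
  nlinarith [sq_nonneg ‖v.2‖]

theorem minkB_le {x y z : ℝ × H} (hx : x ∈ Hyp H) (hy : y ∈ Hyp H) (hz : z ∈ Hyp H) :
    minkB H x z ≤ minkB H x y * minkB H y z +
      √(minkB H x y ^ 2 - 1) * √(minkB H y z ^ 2 - 1) := by
  have hxy := one_le_minkB hx hy
  have hyz := one_le_minkB hy hz
  set a := minkB H x y with ha
  set b := minkB H y z with hb
  have key (s : ℝ) : 0 ≤ (a ^ 2 - 1) * (s * s) + 2 * (a * b - minkB H x z) * s + (b ^ 2 - 1) := by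
    have h := minkB_self_nonpos (v := s • x + z + (-(s * a + b)) • y) hy (by
      simp only [minkB_add_left, minkB_smul_left, hy.1, minkB_comm z y, ← ha, ← hb]
      ring)
    simp only [minkB_add_left, minkB_smul_left, minkB_add_right, minkB_smul_right, hx.1, hy.1,
      hz.1, minkB_comm z y, minkB_comm z x, minkB_comm y x, ← ha, ← hb] at h
    linarith
  have hd := discrim_le_zero key
  rw [discrim] at hd
  rw [← Real.sqrt_mul (by nlinarith)]
  have := Real.abs_le_sqrt (x := minkB H x z - a * b) (y := (a ^ 2 - 1) * (b ^ 2 - 1))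
    (by linarith)
  linarith [le_abs_self (minkB H x z - a * b)]

theorem cosh_hypDist {x y : ℝ × H} (hx : x ∈ Hyp H) (hy : y ∈ Hyp H) :
    Real.cosh (hypDist H x y) = minkB H x y :=
  Real.cosh_arcosh (one_le_minkB hx hy)

theorem hypDist_nonneg {x y : ℝ × H} (hx : x ∈ Hyp H) (hy : y ∈ Hyp H) : 0 ≤ hypDist H x y :=
  Real.arcosh_nonneg (one_le_minkB hx hy)

theorem hypDist_comm (x y : ℝ × H) : hypDist H x y = hypDist H y x := by
  rw [hypDist, minkB_comm, hypDist]

theorem hypDist_self {x : ℝ × H} (hx : x ∈ Hyp H) : hypDist H x x = 0 := by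
  simp [hypDist, hx.1, arcosh]

theorem hypDist_triangle {x y z : ℝ × H} (hx : x ∈ Hyp H) (hy : y ∈ Hyp H) (hz : z ∈ Hyp H) :
    hypDist H x z ≤ hypDist H x y + hypDist H y z := by
  have h1 := hypDist_nonneg hx hy
  have h2 := hypDist_nonneg hy hz
  have h := minkB_le hx hy hz
  rw [← cosh_hypDist hx hy, ← cosh_hypDist hy hz, ← cosh_hypDist hx hz, ← Real.sinh_sq,
    ← Real.sinh_sq, Real.sqrt_sq (Real.sinh_nonneg_iff.2 h1),
    Real.sqrt_sq (Real.sinh_nonneg_iff.2 h2), ← Real.cosh_add, Real.cosh_le_cosh] at h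
  rwa [abs_of_nonneg (hypDist_nonneg hx hz), abs_of_nonneg (add_nonneg h1 h2)] at h

theorem apply_mem (g : Oplus H) {x : ℝ × H} (hx : x ∈ Hyp H) : g.1 x ∈ Hyp H :=
  (g.2.2 x).1 hx

theorem hypDist_apply (g : Oplus H) (x y : ℝ × H) :
    hypDist H (g.1 x) (g.1 y) = hypDist H x y := by
  rw [hypDist, g.2.1, hypDist]

theorem hypDist_pow_le (g : Oplus H) {x : ℝ × H} (hx : x ∈ Hyp H) (n : ℕ) :
    hypDist H ((g ^ n).1 x) x ≤ n * hypDist H (g.1 x) x := by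
  induction n with
  | zero =>
    rw [pow_zero, Nat.cast_zero, zero_mul]
    exact (hypDist_self hx).le
  | succ n ih =>
    have h := hypDist_triangle (apply_mem (g ^ (n + 1)) hx) (apply_mem (g ^ n) hx) hx
    have e : (g ^ (n + 1)).1 x = (g ^ n).1 (g.1 x) := by
      rw [pow_succ]
      rfl
    rw [e, hypDist_apply, ← e] at h
    rw [Nat.cast_succ]
    linarith

/-- Displacements at `x` and `y` differ by at most twice the distance from `x` to `y`. -/
theorem hypDist_apply_le (g : Oplus H) {x y : ℝ × H} (hx : x ∈ Hyp H) (hy : y ∈ Hyp H) :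
    hypDist H (g.1 x) x ≤ hypDist H (g.1 y) y + 2 * hypDist H x y := by
  have h1 := hypDist_triangle (apply_mem g hx) (apply_mem g hy) hx
  have h2 := hypDist_triangle (apply_mem g hy) hy hx
  rw [hypDist_apply] at h1
  rw [hypDist_comm y x] at h2
  linarith

/-- The midpoint of `x` and `g x` is displaced by `g` at most half as much as `x` by `g ^ 2`. -/
theorem exists_two_mul_hypDist_le (g : Oplus H) {x : ℝ × H} (hx : x ∈ Hyp H) :
    ∃ m ∈ Hyp H, 2 * hypDist H (g.1 m) m ≤ hypDist H ((g ^ 2).1 x) x := by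
  have hgx := apply_mem g hx
  have hggx := apply_mem (g ^ 2) hx
  have e2 : g.1 (g.1 x) = (g ^ 2).1 x := by
    rw [pow_two]
    rfl
  have hc := one_le_minkB hgx hx
  set c := minkB H (g.1 x) x with hcdef
  have hcc : minkB H ((g ^ 2).1 x) (g.1 x) = c := by rw [← e2, g.2.1]
  set D := hypDist H ((g ^ 2).1 x) x with hD
  have hD0 : 0 ≤ D := hypDist_nonneg hggx hx
  have hDc : Real.cosh (D / 2) ≤ c := by
    have h := hypDist_pow_le g hx 2
    rw [hcdef, ← cosh_hypDist hgx hx, Real.cosh_le_cosh, abs_of_nonneg (by positivity),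
      abs_of_nonneg (hypDist_nonneg hgx hx)]
    rw [Nat.cast_ofNat] at h
    linarith
  have hcD : minkB H ((g ^ 2).1 x) x = 2 * Real.cosh (D / 2) ^ 2 - 1 := by
    rw [← cosh_hypDist hggx hx, ← hD]
    have := Real.cosh_two_mul (D / 2)
    have h3 := Real.sinh_sq (D / 2)
    rw [mul_div_cancel₀ D two_ne_zero] at this
    linarith
  have hr : (0 : ℝ) < √(2 + 2 * c) := Real.sqrt_pos.2 (by linarith)
  have hr2 : (√(2 + 2 * c))⁻¹ * (√(2 + 2 * c))⁻¹ = (2 + 2 * c)⁻¹ := by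
    rw [← mul_inv, Real.mul_self_sqrt (by linarith)]
  set r := (√(2 + 2 * c))⁻¹
  have hr0 : 0 < r := inv_pos.2 hr
  have hm : r • (x + g.1 x) ∈ Hyp H := by
    refine ⟨?_, ?_⟩
    · simp only [minkB_add_left, minkB_smul_left, minkB_add_right, minkB_smul_right, hx.1, hgx.1,
        minkB_comm x, ← hcdef]
      rw [← mul_add, ← mul_assoc, hr2]
      field_simp
      ring
    · exact mul_pos hr0 (add_pos hx.2 hgx.2)
  refine ⟨_, hm, ?_⟩
  have hq := Real.one_le_cosh (D / 2)
  have hle : minkB H (g.1 (r • (x + g.1 x))) (r • (x + g.1 x)) ≤ Real.cosh (D / 2) := by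
    rw [map_smul, map_add, e2]
    simp only [minkB_add_left, minkB_smul_left, minkB_add_right, minkB_smul_right, hgx.1,
      ← hcdef, hcc, hcD]
    rw [← mul_add, ← mul_assoc, hr2, inv_mul_le_iff₀ (by linarith)]
    nlinarith
  rw [← cosh_hypDist (apply_mem g hm) hm, Real.cosh_le_cosh,
    abs_of_nonneg (hypDist_nonneg (apply_mem g hm) hm), abs_of_nonneg (by positivity)] at hle
  linarith

theorem exists_two_pow_mul_hypDist_le (k : ℕ) (g : Oplus H) {x : ℝ × H} (hx : x ∈ Hyp H) :
    ∃ m ∈ Hyp H, 2 ^ k * hypDist H (g.1 m) m ≤ hypDist H ((g ^ 2 ^ k).1 x) x := by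
  induction k generalizing x with
  | zero => exact ⟨x, hx, by simp⟩
  | succ k ih =>
    obtain ⟨y, hy, hyx⟩ := exists_two_mul_hypDist_le (g ^ 2 ^ k) hx
    obtain ⟨m, hm, hmy⟩ := ih hy
    refine ⟨m, hm, ?_⟩
    rw [← pow_mul, ← pow_succ] at hyx
    rw [pow_succ]
    linarith

theorem bddBelow_range_hypDist (g : Oplus H) :
    BddBelow (Set.range fun y : Hyp H => hypDist H (g.1 (y : ℝ × H)) (y : ℝ × H)) :=
  ⟨0, by
    rintro _ ⟨y, rfl⟩
    exact hypDist_nonneg (apply_mem g y.2) y.2⟩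

/-- `2 ^ k` times the translation length of `g` is at most every displacement of `g ^ 2 ^ k`. -/
theorem two_pow_mul_iInf_hypDist_le (k : ℕ) (g : Oplus H) {x : ℝ × H} (hx : x ∈ Hyp H) :
    2 ^ k * (⨅ y : Hyp H, hypDist H (g.1 (y : ℝ × H)) (y : ℝ × H)) ≤
      hypDist H ((g ^ 2 ^ k).1 x) x := by
  obtain ⟨m, hm, h⟩ := exists_two_pow_mul_hypDist_le k g hx
  refine le_trans ?_ h
  gcongr
  exact ciInf_le (bddBelow_range_hypDist g) ⟨m, hm⟩

/-- If two pairs of points satisfy `cosh d' = (cosh d) ^ t`, then `d' ≤ t * d + log 2`. -/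
theorem hypDist_le_of_minkB_eq_rpow {t : ℝ} (ht : 0 ≤ t) {x y x' y' : ℝ × H} (hx : x ∈ Hyp H)
    (hy : y ∈ Hyp H) (hx' : x' ∈ Hyp H) (hy' : y' ∈ Hyp H)
    (h : minkB H x' y' = minkB H x y ^ t) :
    hypDist H x' y' ≤ t * hypDist H x y + Real.log 2 := by
  rw [← cosh_hypDist hx hy, ← cosh_hypDist hx' hy'] at h
  have hd := hypDist_nonneg hx hy
  set d := hypDist H x y
  set d' := hypDist H x' y'
  have h1 : Real.exp d' ≤ 2 * Real.cosh d' := by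
    rw [Real.cosh_eq]
    linarith [Real.exp_pos (-d')]
  have h2 : Real.cosh d ≤ Real.exp d := by
    rw [Real.cosh_eq]
    linarith [Real.exp_le_exp.2 (show -d ≤ d by linarith)]
  have h3 := Real.rpow_le_rpow (Real.cosh_pos d).le h2 ht
  rw [← Real.exp_mul] at h3
  rw [← Real.exp_le_exp, Real.exp_add, Real.exp_log two_pos, mul_comm t]
  linarith

/-- If two pairs of points satisfy `cosh d' = (cosh d) ^ t`, then `t * d ≤ d' + t * log 2`. -/
theorem mul_hypDist_le_of_minkB_eq_rpow {t : ℝ} (ht : 0 ≤ t) {x y x' y' : ℝ × H}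
    (hx : x ∈ Hyp H) (hy : y ∈ Hyp H) (hx' : x' ∈ Hyp H) (hy' : y' ∈ Hyp H)
    (h : minkB H x' y' = minkB H x y ^ t) :
    t * hypDist H x y ≤ hypDist H x' y' + t * Real.log 2 := by
  rw [← cosh_hypDist hx hy, ← cosh_hypDist hx' hy'] at h
  have hd' := hypDist_nonneg hx' hy'
  set d := hypDist H x y
  set d' := hypDist H x' y'
  have h1 : Real.exp d / 2 ≤ Real.cosh d := by
    rw [Real.cosh_eq]
    linarith [Real.exp_pos (-d)]
  have h2 : Real.cosh d' ≤ Real.exp d' := by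
    rw [Real.cosh_eq]
    linarith [Real.exp_le_exp.2 (show -d' ≤ d' by linarith)]
  have h3 := Real.rpow_le_rpow (by positivity) h1 ht
  have h4 : Real.exp d / 2 = Real.exp (d - Real.log 2) := by
    rw [Real.exp_sub, Real.exp_log two_pos]
  rw [h4, ← Real.exp_mul, ← h] at h3
  linarith [Real.exp_le_exp.1 (h3.trans h2)]

end Hyp

theorem le_of_forall_two_pow_mul_le_add {a b C : ℝ} (h : ∀ k : ℕ, 2 ^ k * a ≤ 2 ^ k * b + C) :
    a ≤ b := by
  by_contra! hab
  obtain ⟨k, hk⟩ := pow_unbounded_of_one_lt (C / (a - b)) one_lt_two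
  rw [div_lt_iff₀ (sub_pos.2 hab)] at hk
  linarith [h k]

/-- the representation `ρ` with equivariant map satisfying
`B (f x) (f y) = (B x y)ᵗ` multiplies all translation lengths by `t`. -/
theorem translation_length_scaling
    (H : Type*) [NormedAddCommGroup H] [InnerProductSpace ℝ H] [CompleteSpace H]
    [TopologicalSpace.SeparableSpace H] (hinf : ¬ FiniteDimensional ℝ H)
    (t : ℝ) (ht0 : 0 < t) (ht1 : t ≤ 1)
    (ρ : Oplus H →* Oplus H) (f : ℝ × H → ℝ × H)
    (hf : ∀ x ∈ Hyp H, f x ∈ Hyp H)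
    (hpow : ∀ x ∈ Hyp H, ∀ y ∈ Hyp H, minkB H (f x) (f y) = (minkB H x y) ^ t)
    (hequiv : ∀ g : Oplus H, ∀ x ∈ Hyp H, f (g.1 x) = (ρ g).1 (f x)) :
    ∀ g : Oplus H,
      (⨅ y : Hyp H, hypDist H ((ρ g).1 (y : ℝ × H)) (y : ℝ × H)) =
        t * ⨅ x : Hyp H, hypDist H (g.1 (x : ℝ × H)) (x : ℝ × H) := by
  intro g
  obtain ⟨x₀, hx₀⟩ := Hyp.nonempty (H := H)
  have : Nonempty (Hyp H) := ⟨⟨x₀, hx₀⟩⟩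
  have hpow_orbit (n : ℕ) {x : ℝ × H} (hx : x ∈ Hyp H) :
      minkB H ((ρ g ^ n).1 (f x)) (f x) = minkB H ((g ^ n).1 x) x ^ t := by
    rw [← map_pow, ← hequiv _ x hx, hpow _ (Hyp.apply_mem _ hx) _ hx]
  refine le_antisymm ?_ (le_ciInf fun ⟨y, hy⟩ => ?_)
  · rw [Real.mul_iInf_of_nonneg ht0.le]
    refine le_ciInf fun ⟨x, hx⟩ => le_of_forall_two_pow_mul_le_add (C := Real.log 2) fun k => ?_
    have h1 := Hyp.two_pow_mul_iInf_hypDist_le k (ρ g) (hf x hx)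
    have h2 := Hyp.hypDist_le_of_minkB_eq_rpow ht0.le (Hyp.apply_mem (g ^ 2 ^ k) hx) hx
      (Hyp.apply_mem (ρ g ^ 2 ^ k) (hf x hx)) (hf x hx) (hpow_orbit _ hx)
    have h3 := mul_le_mul_of_nonneg_left (Hyp.hypDist_pow_le g hx (2 ^ k)) ht0.le
    rw [Nat.cast_pow, Nat.cast_ofNat] at h3
    linarith
  · refine le_of_forall_two_pow_mul_le_add
      (C := 2 * hypDist H (f x₀) y + t * Real.log 2) fun k => ?_
    have h1 := mul_le_mul_of_nonneg_left (Hyp.two_pow_mul_iInf_hypDist_le k g hx₀) ht0.le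
    have h2 := Hyp.mul_hypDist_le_of_minkB_eq_rpow ht0.le (Hyp.apply_mem (g ^ 2 ^ k) hx₀) hx₀
      (Hyp.apply_mem (ρ g ^ 2 ^ k) (hf x₀ hx₀)) (hf x₀ hx₀) (hpow_orbit _ hx₀)
    have h3 := Hyp.hypDist_apply_le (ρ g ^ 2 ^ k) (hf x₀ hx₀) hy
    have h4 := Hyp.hypDist_pow_le (ρ g) hy (2 ^ k)
    rw [Nat.cast_pow, Nat.cast_ofNat] at h4
    linarith
end

section
/- Let H be a real Hilbert space, let G be a group acting on the hyperboloid ℋ(H) by B-preserving bijections (i.e. via a homomorphism from G to the group of bijections φ of ℋ(H) with B(φ(u), φ(v)) = B(u,v) for all u,v), and let p ∈ ℋ(H). Then the orbit function g ↦ B(g·p, p) is bounded on G if and only if G fixes a point of ℋ(H), i.e. there exists q ∈ ℋ(H) with g·q = q for all g ∈ G. -/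
open scoped RealInnerProductSpace

variable (H : Type*) [NormedAddCommGroup H] [InnerProductSpace ℝ H]

section Hyperboloid

variable {H : Type*} [NormedAddCommGroup H] [InnerProductSpace ℝ H]

theorem minkB_comm_s11 (x y : ℝ × H) : minkB H x y = minkB H y x := by
  simp only [minkB, real_inner_comm, mul_comm]

theorem Hyp.fst_sq {x : ℝ × H} (hx : x ∈ Hyp H) : x.1 ^ 2 = 1 + ‖x.2‖ ^ 2 := by
  have h := hx.1
  rw [minkB, real_inner_self_eq_norm_sq] at h
  linarith

theorem Hyp.norm_snd_le {x : ℝ × H} (hx : x ∈ Hyp H) : ‖x.2‖ ≤ x.1 := by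
  have := Hyp.fst_sq hx
  have := hx.2
  nlinarith [norm_nonneg x.2]

theorem Hyp.one_le_mul_sub {x y : ℝ × H} (hx : x ∈ Hyp H) (hy : y ∈ Hyp H) :
    1 ≤ x.1 * y.1 - ‖x.2‖ * ‖y.2‖ := by
  have h1 := Hyp.fst_sq hx
  have h2 := Hyp.fst_sq hy
  have h3 : (1 + ‖x.2‖ * ‖y.2‖) ^ 2 ≤ (x.1 * y.1) ^ 2 := by
    rw [mul_pow, h1, h2]
    nlinarith [sq_nonneg (‖x.2‖ - ‖y.2‖)]
  have := abs_le_of_sq_le_sq h3 (mul_pos hx.2 hy.2).le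
  linarith [(abs_le.1 this).2]

theorem Hyp.one_le_minkB_s11 {x y : ℝ × H} (hx : x ∈ Hyp H) (hy : y ∈ Hyp H) :
    1 ≤ minkB H x y := by
  have := Hyp.one_le_mul_sub hx hy
  have := real_inner_le_norm x.2 y.2
  rw [minkB]
  linarith

theorem Hyp.fst_le {x y : ℝ × H} (hx : x ∈ Hyp H) (hy : y ∈ Hyp H) :
    x.1 ≤ 2 * y.1 * minkB H x y := by
  have h1 := Hyp.fst_sq hy
  have h2 := Hyp.norm_snd_le hx
  have h3 := Hyp.norm_snd_le hy
  have h4 : x.1 * (y.1 - ‖y.2‖) ≤ minkB H x y := by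
    have := real_inner_le_norm x.2 y.2
    have := mul_le_mul_of_nonneg_right h2 (norm_nonneg y.2)
    rw [minkB]
    linarith
  have h5 : 1 ≤ 2 * y.1 * (y.1 - ‖y.2‖) := by
    nlinarith [sq_nonneg (y.1 - ‖y.2‖)]
  calc x.1 ≤ x.1 * (2 * y.1 * (y.1 - ‖y.2‖)) := le_mul_of_one_le_right hx.2.le h5
    _ = 2 * y.1 * (x.1 * (y.1 - ‖y.2‖)) := by ring
    _ ≤ _ := mul_le_mul_of_nonneg_left h4 (by linarith [hy.2])

theorem Hyp.minkB_le_s11 {x y : ℝ × H} (hx : x ∈ Hyp H) (hy : y ∈ Hyp H) :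
    minkB H x y ≤ 2 * (x.1 * y.1) := by
  have h1 := (abs_le.1 (abs_real_inner_le_norm x.2 y.2)).1
  have h2 := mul_le_mul (Hyp.norm_snd_le hx) (Hyp.norm_snd_le hy) (norm_nonneg _) hx.2.le
  rw [minkB]
  linarith

theorem Hyp.abs_fst_sub_le {x y : ℝ × H} (hx : x ∈ Hyp H) (hy : y ∈ Hyp H) :
    |x.1 - y.1| ≤ ‖x.2 - y.2‖ := by
  apply abs_le_of_sq_le_sq' _ (norm_nonneg _) |> abs_le.2
  rw [norm_sub_sq_real]
  have h := Hyp.one_le_minkB_s11 hx hy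
  rw [minkB] at h
  linarith [Hyp.fst_sq hx, Hyp.fst_sq hy]

theorem Hyp.dist_sq_le {x y : ℝ × H} (hx : x ∈ Hyp H) (hy : y ∈ Hyp H) :
    dist x y ^ 2 ≤ (x.1 + y.1) ^ 2 * (minkB H x y - 1) / 2 := by
  have hd : dist x y = ‖x.2 - y.2‖ := by
    rw [Prod.dist_eq, dist_eq_norm, dist_eq_norm, Real.norm_eq_abs]
    exact max_eq_right (Hyp.abs_fst_sub_le hx hy)
  rw [hd]
  have hN := norm_sub_sq_real x.2 y.2
  have h1 := Hyp.fst_sq hx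
  have h2 := Hyp.fst_sq hy
  have h3 := Hyp.one_le_mul_sub hx hy
  set N := ‖x.2 - y.2‖
  have e : 2 * (minkB H x y - 1) = N ^ 2 - (x.1 - y.1) ^ 2 := by
    rw [minkB]
    linarith
  have h4 : ((x.1 - y.1) * (x.1 + y.1)) ^ 2 ≤ N ^ 2 * (‖x.2‖ + ‖y.2‖) ^ 2 := by
    have e2 : (x.1 - y.1) * (x.1 + y.1) = (‖x.2‖ - ‖y.2‖) * (‖x.2‖ + ‖y.2‖) := by linarith
    rw [e2, mul_pow]
    refine mul_le_mul_of_nonneg_right ?_ (sq_nonneg _)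
    exact sq_le_sq.2 ((abs_norm_sub_norm_le _ _).trans (le_abs_self _))
  have h5 : 4 ≤ (x.1 + y.1) ^ 2 - (‖x.2‖ + ‖y.2‖) ^ 2 := by linarith
  have h6 := mul_le_mul_of_nonneg_left h5 (sq_nonneg N)
  have h7 : (x.1 + y.1) ^ 2 * (2 * (minkB H x y - 1)) =
      N ^ 2 * (x.1 + y.1) ^ 2 - ((x.1 - y.1) * (x.1 + y.1)) ^ 2 := by
    rw [e]
    ring
  linarith

/-- Two points of the hyperboloid have a midpoint, the normalization of their sum. -/
theorem Hyp.exists_midpoint {x y : ℝ × H} (hx : x ∈ Hyp H) (hy : y ∈ Hyp H) :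
    ∃ m ∈ Hyp H, ∀ z,
      √(2 + 2 * minkB H x y) * minkB H m z = minkB H x z + minkB H y z := by
  have hB := Hyp.one_le_minkB_s11 hx hy
  set r := √(2 + 2 * minkB H x y) with hr
  have hr0 : 0 < r := Real.sqrt_pos.2 (by linarith)
  have hr2 : r ^ 2 = 2 + 2 * minkB H x y := Real.sq_sqrt (by linarith)
  have key : ∀ z, r * minkB H (r⁻¹ • (x + y)) z = minkB H x z + minkB H y z := by
    intro z
    simp only [minkB, Prod.smul_fst, Prod.smul_snd, Prod.fst_add, Prod.snd_add,
      real_inner_smul_left, inner_add_left, smul_eq_mul]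
    field_simp
    ring
  refine ⟨r⁻¹ • (x + y), ⟨?_, ?_⟩, key⟩
  · have h1 := key (r⁻¹ • (x + y))
    have h2 := key x
    have h3 := key y
    rw [minkB_comm_s11 x (r⁻¹ • (x + y)), minkB_comm_s11 y (r⁻¹ • (x + y))] at h1
    rw [hx.1, minkB_comm_s11 y x] at h2
    rw [hy.1] at h3
    have : r ^ 2 * minkB H (r⁻¹ • (x + y)) (r⁻¹ • (x + y)) = r ^ 2 * 1 := by
      linear_combination r * h1 + h2 + h3 - hr2
    exact mul_left_cancel₀ (by positivity) this
  · have := hx.2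
    have := hy.2
    simp only [Prod.smul_fst, Prod.fst_add, smul_eq_mul]
    positivity

theorem continuous_minkB_left (z : ℝ × H) : Continuous fun x => minkB H x z := by
  unfold minkB
  fun_prop

theorem isClosed_Hyp : IsClosed (Hyp H) := by
  have : Hyp H = {v | minkB H v v = 1} ∩ {v | 0 ≤ v.1} := by
    ext v
    refine ⟨fun h => ⟨h.1, h.2.le⟩, fun h => ⟨h.1, lt_of_le_of_ne h.2 fun h0 => ?_⟩⟩
    have h1 : minkB H v v = 1 := h.1
    rw [minkB, ← h0, real_inner_self_eq_norm_sq] at h1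
    nlinarith [sq_nonneg ‖v.2‖]
  rw [this]
  refine (isClosed_eq ?_ continuous_const).inter (isClosed_le continuous_const continuous_fst)
  unfold minkB
  fun_prop

/-- A bounded nonempty subset of the hyperboloid has a unique circumcenter `q`: for the optimal
bound `R`, it is the only point with `minkB H q z ≤ R` for all `z` in the subset. -/
theorem Hyp.exists_unique_circumcenter [CompleteSpace H] {S : Set (ℝ × H)} (hS : S ⊆ Hyp H)
    {p : ℝ × H} (hpS : p ∈ S) {M : ℝ} {x₀ : ℝ × H} (hx₀ : x₀ ∈ Hyp H)
    (hM : ∀ z ∈ S, minkB H x₀ z ≤ M) :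
    ∃ R : ℝ, ∃! q : ℝ × H, q ∈ Hyp H ∧ ∀ z ∈ S, minkB H q z ≤ R := by
  have hp := hS hpS
  set A : Set ℝ := {c | ∃ x ∈ Hyp H, ∀ z ∈ S, minkB H x z ≤ c} with hA
  have hA1 : ∀ c ∈ A, 1 ≤ c := fun c ⟨x, hx, h⟩ =>
    (Hyp.one_le_minkB_s11 hx hp).trans (h p hpS)
  have hAne : A.Nonempty := ⟨M, x₀, hx₀, hM⟩
  have hAb : BddBelow A := ⟨1, hA1⟩
  set R := sInf A
  have hR1 : 1 ≤ R := le_csInf hAne hA1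
  have close : ∀ ε, 0 ≤ ε → ε ≤ 1 → ∀ x ∈ Hyp H, ∀ y ∈ Hyp H,
      (∀ z ∈ S, minkB H x z ≤ R + ε) → (∀ z ∈ S, minkB H y z ≤ R + ε) →
      dist x y ^ 2 ≤ (4 * p.1 * (R + 1)) ^ 2 * (4 * R + 2) / 2 * ε := by
    intro ε h0 h1 x hx y hy hxz hyz
    obtain ⟨m, hm, hmz⟩ := Hyp.exists_midpoint hx hy
    have hB := Hyp.one_le_minkB_s11 hx hy
    set r := √(2 + 2 * minkB H x y)
    have hr0 : 0 < r := Real.sqrt_pos.2 (by linarith)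
    have hr2 : r ^ 2 = 2 + 2 * minkB H x y := Real.sq_sqrt (by linarith)
    have hmem : 2 * (R + ε) / r ∈ A := by
      refine ⟨m, hm, fun z hz => ?_⟩
      rw [le_div_iff₀ hr0, mul_comm, hmz]
      linarith [hxz z hz, hyz z hz]
    have h2 : R * r ≤ 2 * (R + ε) := (le_div_iff₀ hr0).1 (csInf_le hAb hmem)
    have h3 : R ^ 2 * r ^ 2 ≤ 4 * (R + ε) ^ 2 := by
      have := pow_le_pow_left₀ (by positivity) h2 2
      linarith
    have h4 : minkB H x y - 1 ≤ (4 * R + 2) * ε := by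
      rw [hr2] at h3
      have h5 : minkB H x y - 1 ≤ R ^ 2 * (minkB H x y - 1) :=
        le_mul_of_one_le_left (by linarith) (one_le_pow₀ hR1)
      nlinarith
    have bound : ∀ w ∈ Hyp H, (∀ z ∈ S, minkB H w z ≤ R + ε) → w.1 ≤ 2 * p.1 * (R + 1) := by
      intro w hw hwz
      refine (Hyp.fst_le hw hp).trans (mul_le_mul_of_nonneg_left ?_ (by linarith [hp.2]))
      linarith [hwz p hpS]
    have h6 : (x.1 + y.1) ^ 2 ≤ (4 * p.1 * (R + 1)) ^ 2 := by
      refine pow_le_pow_left₀ (by linarith [hx.2, hy.2]) ?_ 2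
      linarith [bound x hx hxz, bound y hy hyz]
    have h7 := mul_le_mul h6 h4 (by linarith) (sq_nonneg _)
    linarith [Hyp.dist_sq_le hx hy]
  have approx : ∀ n : ℕ, ∃ x ∈ Hyp H, ∀ z ∈ S, minkB H x z ≤ R + 1 / ((n : ℝ) + 1) := by
    intro n
    obtain ⟨c, ⟨x, hx, hxz⟩, hc⟩ :=
      exists_lt_of_csInf_lt hAne (lt_add_of_pos_right R (Nat.one_div_pos_of_nat (n := n)))
    exact ⟨x, hx, fun z hz => (hxz z hz).trans hc.le⟩
  choose x hx hxz using approx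
  set K := (4 * p.1 * (R + 1)) ^ 2 * (4 * R + 2) / 2
  have mono : ∀ {N n : ℕ}, N ≤ n → ∀ z ∈ S, minkB H (x n) z ≤ R + 1 / ((N : ℝ) + 1) :=
    fun h z hz => (hxz _ z hz).trans (by linarith [Nat.one_div_le_one_div (α := ℝ) h])
  have tend : Filter.Tendsto (fun n : ℕ => √(K * (1 / ((n : ℝ) + 1)))) Filter.atTop (nhds 0) := by
    have := ((tendsto_one_div_add_atTop_nhds_zero_nat (𝕜 := ℝ)).const_mul K).sqrt
    simpa using this
  have hc : CauchySeq x := by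
    refine cauchySeq_of_le_tendsto_0 _ (fun n m N hn hm => Real.le_sqrt_of_sq_le ?_) tend
    refine close _ Nat.one_div_pos_of_nat.le ?_ _ (hx n) _ (hx m) (mono hn) (mono hm)
    simpa using Nat.one_div_le_one_div (α := ℝ) (Nat.zero_le N)
  obtain ⟨q, hq⟩ := cauchySeq_tendsto_of_complete hc
  have hqH : q ∈ Hyp H := isClosed_Hyp.mem_of_tendsto hq (Filter.Eventually.of_forall hx)
  have hqz : ∀ z ∈ S, minkB H q z ≤ R := by
    intro z hz
    have h1 := ((continuous_minkB_left z).tendsto q).comp hq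
    have h2 := (tendsto_one_div_add_atTop_nhds_zero_nat (𝕜 := ℝ)).const_add R
    rw [add_zero] at h2
    exact le_of_tendsto_of_tendsto' h1 h2 fun n => hxz n z hz
  refine ⟨R, q, ⟨hqH, hqz⟩, fun y ⟨hy, hyz⟩ => ?_⟩
  have := close 0 le_rfl zero_le_one y hy q hqH (by simpa using hyz) (by simpa using hqz)
  rw [mul_zero] at this
  exact dist_eq_zero.1 (pow_eq_zero_iff two_ne_zero |>.1 (this.antisymm (sq_nonneg _)))

end Hyperboloid

/-- for a group acting on the hyperboloid by `B`-preserving bijections,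
the orbit function `g ↦ B(g p, p)` is bounded iff the group fixes a point. -/
theorem bounded_orbit_iff_fixed_point
    (H : Type*) [NormedAddCommGroup H] [InnerProductSpace ℝ H] [CompleteSpace H]
    {G : Type*} [Group G] (ρ : G →* Equiv.Perm (Hyp H))
    (hρ : ∀ (g : G) (u v : Hyp H),
      minkB H (ρ g u : ℝ × H) (ρ g v : ℝ × H) = minkB H (u : ℝ × H) (v : ℝ × H))
    (p : Hyp H) :
    (∃ M : ℝ, ∀ g : G, minkB H (ρ g p : ℝ × H) (p : ℝ × H) ≤ M) ↔
      ∃ q : Hyp H, ∀ g : G, ρ g q = q := by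
  constructor
  · rintro ⟨M, hM⟩
    obtain ⟨R, q, ⟨hq, hqR⟩, huniq⟩ := Hyp.exists_unique_circumcenter
      (S := Set.range fun g => (ρ g p : ℝ × H)) (Set.range_subset_iff.2 fun g => (ρ g p).2)
      (p := p) ⟨1, by simp⟩ (M := M) p.2
      (Set.forall_mem_range.2 fun g => by rw [minkB_comm_s11]; exact hM g)
    refine ⟨⟨q, hq⟩, fun g => Subtype.ext (huniq _ ⟨(ρ g ⟨q, hq⟩).2, ?_⟩)⟩
    rintro _ ⟨k, rfl⟩
    have hk : ρ k p = ρ g (ρ (g⁻¹ * k) p) := by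
      rw [← Equiv.Perm.mul_apply, ← map_mul, mul_inv_cancel_left]
    simp only [hk, hρ]
    exact hqR _ ⟨_, rfl⟩
  · rintro ⟨q, hq⟩
    refine ⟨2 * (2 * (q : ℝ × H).1 * minkB H p q * (p : ℝ × H).1), fun g => ?_⟩
    have h1 := Hyp.fst_le (ρ g p).2 q.2
    have h2 := hρ g p q
    rw [hq g] at h2
    rw [h2] at h1
    have := mul_le_mul_of_nonneg_right h1 p.2.2.le
    linarith [Hyp.minkB_le_s11 (ρ g p).2 p.2]
end

section
/- (Cartan decomposition of the hyperbolic isometry group.) Let H be a nonzero real Hilbert space, fix a unit vector e ∈ H, set p = (1, 0) ∈ ℋ(H), and for u ∈ ℝ define l_u ∈ O₊(B) by l_u(s, h) = ( s·cosh u + ⟨h,e⟩·sinh u , (h − ⟨h,e⟩·e) + (s·sinh u + ⟨h,e⟩·cosh u)·e ). Then for every g ∈ O₊(B) there exist u ≥ 0 and k₁, k₂ ∈ O₊(B) with k₁·p = p and k₂·p = p such that g = k₁ ∘ l_u ∘ k₂. -/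
open scoped RealInnerProductSpace

variable (H : Type*) [NormedAddCommGroup H] [InnerProductSpace ℝ H]

/-- The hyperbolic translation `l_u` along the axis through `p = (1,0)` in direction
of a unit vector `e ∈ H`. -/
noncomputable def Lmap {H : Type*} [NormedAddCommGroup H] [InnerProductSpace ℝ H]
    (e : H) (u : ℝ) (v : ℝ × H) : ℝ × H :=
  (v.1 * Real.cosh u + ⟪v.2, e⟫ * Real.sinh u,
    (v.2 - ⟪v.2, e⟫ • e) + (v.1 * Real.sinh u + ⟪v.2, e⟫ * Real.cosh u) • e)

theorem Lmap_minkB {H : Type*} [NormedAddCommGroup H] [InnerProductSpace ℝ H]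
    {e : H} (he : ‖e‖ = 1) (u : ℝ) (v w : ℝ × H) :
    minkB H (Lmap e u v) (Lmap e u w) = minkB H v w := by
  have hee : ⟪e, e⟫ = 1 := by simp [he]
  have hc := Real.cosh_sq u
  simp only [minkB, Lmap, inner_add_left, inner_add_right, inner_sub_left, inner_sub_right,
    real_inner_smul_left, real_inner_smul_right, hee, ← real_inner_comm e w.2]
  linear_combination (v.1 * w.1 - ⟪v.2, e⟫ * ⟪w.2, e⟫) * hc

theorem Lmap_neg_Lmap {H : Type*} [NormedAddCommGroup H] [InnerProductSpace ℝ H]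
    {e : H} (he : ‖e‖ = 1) (u : ℝ) (v : ℝ × H) : Lmap e (-u) (Lmap e u v) = v := by
  have hee : ⟪e, e⟫ = 1 := by simp [he]
  have hc := Real.cosh_sq u
  have hi : ⟪(Lmap e u v).2, e⟫ = v.1 * Real.sinh u + ⟪v.2, e⟫ * Real.cosh u := by
    simp [Lmap, inner_add_left, inner_sub_left, real_inner_smul_left, he]
  ext
  · rw [Lmap, hi, Real.cosh_neg, Real.sinh_neg]
    simp only [Lmap]
    linear_combination v.1 * hc
  · rw [Lmap, hi, Real.cosh_neg, Real.sinh_neg]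
    simp only [Lmap]
    match_scalars
    · ring
    · linear_combination ⟪v.2, e⟫ * hc

theorem Lmap_mem_Hyp {H : Type*} [NormedAddCommGroup H] [InnerProductSpace ℝ H]
    {e : H} (he : ‖e‖ = 1) (u : ℝ) {v : ℝ × H} (hv : v ∈ Hyp H) : Lmap e u v ∈ Hyp H := by
  refine ⟨(Lmap_minkB he u v v).trans hv.1, ?_⟩
  obtain ⟨h1, h2⟩ := hv
  have hi : |⟪v.2, e⟫| ≤ ‖v.2‖ := by simpa [he] using abs_real_inner_le_norm v.2 e
  rw [minkB, real_inner_self_eq_norm_sq] at h1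
  have hlt : |⟪v.2, e⟫| < v.1 :=
    hi.trans_lt (by nlinarith [norm_nonneg v.2])
  have hs : |Real.sinh u| < Real.cosh u :=
    abs_lt_of_sq_lt_sq (by linarith [Real.cosh_sq u]) (Real.cosh_pos u).le
  have hm : |⟪v.2, e⟫ * Real.sinh u| < v.1 * Real.cosh u := by
    rw [abs_mul]
    exact mul_lt_mul'' hlt hs (abs_nonneg _) (abs_nonneg _)
  show 0 < v.1 * Real.cosh u + ⟪v.2, e⟫ * Real.sinh u
  linarith [(abs_lt.mp hm).1]

theorem mem_Hyp_iff_Lmap_mem_Hyp {H : Type*} [NormedAddCommGroup H] [InnerProductSpace ℝ H]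
    {e : H} (he : ‖e‖ = 1) (u : ℝ) (v : ℝ × H) : v ∈ Hyp H ↔ Lmap e u v ∈ Hyp H :=
  ⟨Lmap_mem_Hyp he u, fun h => Lmap_neg_Lmap he u v ▸ Lmap_mem_Hyp he (-u) h⟩

/-- The hyperbolic translation `Lmap e u` as an element of `Oplus H`. -/
noncomputable def LmapOplus {H : Type*} [NormedAddCommGroup H] [InnerProductSpace ℝ H]
    {e : H} (he : ‖e‖ = 1) (u : ℝ) : Oplus H :=
  ⟨{ toFun := Lmap e u
     invFun := Lmap e (-u)
     left_inv := Lmap_neg_Lmap he u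
     right_inv := fun v => by simpa using Lmap_neg_Lmap he (-u) v
     map_add' := fun v w => by
       ext
       · simp only [Lmap, Prod.fst_add, Prod.snd_add, inner_add_left]
         ring
       · simp only [Lmap, Prod.fst_add, Prod.snd_add, inner_add_left]
         module
     map_smul' := fun c v => by
       ext
       · simp only [Lmap, Prod.smul_fst, Prod.smul_snd, real_inner_smul_left, smul_eq_mul,
           RingHom.id_apply]
         ring
       · simp only [Lmap, Prod.smul_fst, Prod.smul_snd, real_inner_smul_left, smul_eq_mul,
           RingHom.id_apply]
         module
     continuous_toFun := by
       unfold Lmap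
       fun_prop
     continuous_invFun := by
       unfold Lmap
       fun_prop },
    Lmap_minkB he u, mem_Hyp_iff_Lmap_mem_Hyp he u⟩

/-- A linear isometry of `H`, extended by the identity on the time axis. -/
noncomputable def LinearIsometryEquiv.toOplus {H : Type*} [NormedAddCommGroup H]
    [InnerProductSpace ℝ H] (r : H ≃ₗᵢ[ℝ] H) : Oplus H :=
  ⟨(ContinuousLinearEquiv.refl ℝ ℝ).prodCongr r.toContinuousLinearEquiv,
    fun v w => by simp [minkB], fun v => by simp [Hyp, minkB]⟩

/-- Cartan decomposition `O₊(B) = O · L · O`: every `g ∈ O₊(B)` can be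
written `k₁ ∘ l_u ∘ k₂` with `u ≥ 0` and `k₁, k₂` fixing the point `p = (1,0)`;
moreover each `l_u` lies in `O₊(B)`. -/
theorem cartan_decomposition
    (H : Type*) [NormedAddCommGroup H] [InnerProductSpace ℝ H] [CompleteSpace H]
    (e : H) (he : ‖e‖ = 1) (g : Oplus H) :
    (∀ u : ℝ, (∀ v w : ℝ × H, minkB H (Lmap e u v) (Lmap e u w) = minkB H v w) ∧
      (∀ v : ℝ × H, v ∈ Hyp H ↔ Lmap e u v ∈ Hyp H)) ∧
    ∃ u : ℝ, 0 ≤ u ∧ ∃ k₁ k₂ : Oplus H,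
      k₁.1 ((1 : ℝ), (0 : H)) = ((1 : ℝ), (0 : H)) ∧
      k₂.1 ((1 : ℝ), (0 : H)) = ((1 : ℝ), (0 : H)) ∧
      ∀ v : ℝ × H, g.1 v = k₁.1 (Lmap e u (k₂.1 v)) := by
  refine ⟨fun u => ⟨Lmap_minkB he u, mem_Hyp_iff_Lmap_mem_Hyp he u⟩, ?_⟩
  obtain ⟨h1, h2⟩ : g.1 (1, 0) ∈ Hyp H := (g.2.2 _).1 (by simp [Hyp, minkB])
  set q := g.1 (1, 0) with hq
  rw [minkB, real_inner_self_eq_norm_sq] at h1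
  have hsinh : Real.sinh (Real.arsinh ‖q.2‖) = ‖q.2‖ := Real.sinh_arsinh _
  have hcosh : Real.cosh (Real.arsinh ‖q.2‖) = q.1 := by
    rw [Real.cosh_arsinh, Real.sqrt_eq_iff_mul_self_eq (by positivity) h2.le]
    linarith
  let r : H ≃ₗᵢ[ℝ] H := (ℝ ∙ (‖q.2‖ • e - q.2))ᗮ.reflection
  have hr : r (‖q.2‖ • e) = q.2 := Submodule.reflection_sub (by simp [norm_smul, he])
  let k : Oplus H := r.toOplus
  let l : Oplus H := LmapOplus he (Real.arsinh ‖q.2‖)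
  have hkl : (k * l).1 (1, 0) = q := by
    show ((Lmap e (Real.arsinh ‖q.2‖) (1, 0)).1, r (Lmap e (Real.arsinh ‖q.2‖) (1, 0)).2) = q
    simp [Lmap, hsinh, hcosh, hr, -map_smul]
  refine ⟨Real.arsinh ‖q.2‖, Real.arsinh_nonneg_iff.2 (norm_nonneg _), k, (k * l)⁻¹ * g,
    ?_, ?_, fun v => ?_⟩
  · show ((1 : ℝ), r 0) = _
    rw [map_zero]
  · show (k * l).1.symm (g.1 (1, 0)) = _
    rw [← hq, ← hkl, ContinuousLinearEquiv.symm_apply_apply]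
  · show g.1 v = (k * l).1 ((k * l).1.symm (g.1 v))
    rw [ContinuousLinearEquiv.apply_symm_apply]
end

section
/- Fix u ≥ 0 and 0 < t ≤ 1. For each n ≥ 2 let σ_n denote the normalized (probability) surface measure on the unit sphere S^{n−1} ⊂ ℝⁿ and let b₁ denote the first coordinate of b ∈ S^{n−1}. Then lim_{n→∞} ∫_{S^{n−1}} ( cosh u + b₁·sinh u )^t dσ_n(b) = (cosh u)^t. -/
open MeasureTheory

/-- The normalized (probability) surface measure on the unit sphere of
`EuclideanSpace ℝ (Fin n)`. -/
noncomputable def sphereProb (n : ℕ) :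
    Measure (Metric.sphere (0 : EuclideanSpace ℝ (Fin n)) 1) :=
  ((volume : Measure (EuclideanSpace ℝ (Fin n))).toSphere Set.univ)⁻¹ •
    (volume : Measure (EuclideanSpace ℝ (Fin n))).toSphere

section Rotation

open scoped Pointwise

variable {E : Type*} [NormedAddCommGroup E] [InnerProductSpace ℝ E] [FiniteDimensional ℝ E]
  [MeasurableSpace E] [BorelSpace E]

/-- The surface measure on the unit sphere is invariant under linear isometries. -/
theorem measurePreserving_toSphere_of_linearIsometryEquiv (L : E ≃ₗᵢ[ℝ] E)
    (f : Metric.sphere (0 : E) 1 → Metric.sphere (0 : E) 1) (hf : ∀ b, (f b : E) = L b) :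
    MeasurePreserving f (volume : Measure E).toSphere (volume : Measure E).toSphere := by
  have hfm : Measurable f := by
    refine (continuous_induced_rng.2 ?_).measurable
    simpa only [Function.comp_def, hf] using L.continuous.comp continuous_subtype_val
  refine ⟨hfm, Measure.ext fun s hs => ?_⟩
  rw [Measure.map_apply hfm hs, Measure.toSphere_apply' _ (hfm hs), Measure.toSphere_apply' _ hs,
    ← L.measurePreserving.measure_preimage_emb L.toHomeomorph.measurableEmbedding
      (Set.Ioo (0 : ℝ) 1 • (Subtype.val '' s))]
  congr 2
  ext x
  simp only [Set.mem_smul, Set.mem_image, Set.mem_preimage]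
  constructor
  · rintro ⟨r, hr, _, ⟨b, hb, rfl⟩, rfl⟩
    exact ⟨r, hr, _, ⟨f b, hb, rfl⟩, by simp [hf]⟩
  · rintro ⟨r, hr, _, ⟨b, hb, rfl⟩, hx⟩
    have hfb : f ⟨L.symm b, by simp⟩ = b := Subtype.ext (by simp [hf])
    refine ⟨r, hr, _, ⟨⟨L.symm b, by simp⟩, hfb.symm ▸ hb, rfl⟩, L.injective ?_⟩
    simpa using hx

end Rotation

instance sphereProb.instIsProbabilityMeasure (n : ℕ) : IsProbabilityMeasure (sphereProb (n + 1)) where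
  measure_univ := by
    have h0 : (volume : Measure (EuclideanSpace ℝ (Fin (n + 1)))).toSphere Set.univ ≠ 0 :=
      Measure.measure_univ_ne_zero.2 (Measure.toSphere_ne_zero _)
    simp only [sphereProb, Measure.smul_apply, smul_eq_mul]
    exact ENNReal.inv_mul_cancel h0 (measure_ne_top _ _)

/-- All coordinates on the sphere have the same second moment. -/
theorem integral_sphereProb_coord_sq_eq (n : ℕ) (i j : Fin n) :
    ∫ b, (b : EuclideanSpace ℝ (Fin n)) i ^ 2 ∂sphereProb n =
      ∫ b, (b : EuclideanSpace ℝ (Fin n)) j ^ 2 ∂sphereProb n := by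
  let L := LinearIsometryEquiv.piLpCongrLeft 2 ℝ ℝ (Equiv.swap i j)
  have key := measurePreserving_toSphere_of_linearIsometryEquiv L
    (fun b => ⟨L b, by simp⟩) (fun _ => rfl)
  have hm : Measurable fun b : Metric.sphere (0 : EuclideanSpace ℝ (Fin n)) 1 =>
      (b : EuclideanSpace ℝ (Fin n)) i ^ 2 := by fun_prop
  simp only [sphereProb, integral_smul_measure]
  congr 1
  rw [← key.map_eq, integral_map key.measurable.aemeasurable hm.aestronglyMeasurable, key.map_eq]
  simp [L, LinearIsometryEquiv.piLpCongrLeft_apply]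

theorem integrable_sphereProb_of_continuous (n : ℕ)
    {f : Metric.sphere (0 : EuclideanSpace ℝ (Fin (n + 1))) 1 → ℝ} (hf : Continuous f) :
    Integrable f (sphereProb (n + 1)) :=
  hf.integrable_of_hasCompactSupport (HasCompactSupport.of_compactSpace f)

/-- The second moment of a coordinate on the unit sphere of `ℝⁿ⁺¹` is `1 / (n + 1)`. -/
theorem integral_sphereProb_coord_sq (n : ℕ) (i : Fin (n + 1)) :
    ∫ b, (b : EuclideanSpace ℝ (Fin (n + 1))) i ^ 2 ∂sphereProb (n + 1) = 1 / (n + 1) := by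
  have hsum : ∑ j, ∫ b, (b : EuclideanSpace ℝ (Fin (n + 1))) j ^ 2 ∂sphereProb (n + 1) = 1 := by
    rw [← integral_finsetSum _ fun j _ =>
      integrable_sphereProb_of_continuous n (by fun_prop)]
    have h (b : Metric.sphere (0 : EuclideanSpace ℝ (Fin (n + 1))) 1) :
        ∑ j, (b : EuclideanSpace ℝ (Fin (n + 1))) j ^ 2 = 1 := by
      rw [← EuclideanSpace.real_norm_sq_eq]
      simp
    simp [h]
  rw [Finset.sum_congr rfl fun j _ => integral_sphereProb_coord_sq_eq (n + 1) j i] at hsum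
  simp only [Finset.sum_const, Finset.card_univ, Fintype.card_fin, nsmul_eq_mul] at hsum
  push_cast at hsum
  field_simp
  linarith

/-- The mean absolute value of a coordinate on the unit sphere of `ℝⁿ⁺¹` is at most
`1 / √(n + 1)`. -/
theorem integral_sphereProb_abs_coord_le (n : ℕ) (i : Fin (n + 1)) :
    ∫ b, |(b : EuclideanSpace ℝ (Fin (n + 1))) i| ∂sphereProb (n + 1) ≤ 1 / √((n : ℝ) + 1) := by
  have hn : (0 : ℝ) < n + 1 := by positivity
  set r := √((n : ℝ) + 1) with hr
  have hr0 : 0 < r := Real.sqrt_pos.2 hn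
  have hr2 : r ^ 2 = n + 1 := Real.sq_sqrt hn.le
  calc
    _ ≤ ∫ b, (1 / (2 * r) + r / 2 * (b : EuclideanSpace ℝ (Fin (n + 1))) i ^ 2)
        ∂sphereProb (n + 1) := by
      refine integral_mono (integrable_sphereProb_of_continuous n (by fun_prop))
        (integrable_sphereProb_of_continuous n (by fun_prop)) fun b => ?_
      set x := (b : EuclideanSpace ℝ (Fin (n + 1))) i
      have h : 1 / (2 * r) + r / 2 * x ^ 2 - |x| = (r * |x| - 1) ^ 2 / (2 * r) := by
        field_simp
        rw [← sq_abs x]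
        ring
      have : 0 ≤ (r * |x| - 1) ^ 2 / (2 * r) := by positivity
      change |x| ≤ 1 / (2 * r) + r / 2 * x ^ 2
      linarith
    _ = 1 / r := by
      rw [integral_add (integrable_sphereProb_of_continuous n (by fun_prop))
        (integrable_sphereProb_of_continuous n (by fun_prop)), integral_const_mul,
        integral_sphereProb_coord_sq, ← hr2]
      simp
      field_simp
      norm_num

theorem abs_one_add_rpow_sub_one_le {z t : ℝ} (hz : -1 ≤ z) (ht0 : 0 ≤ t) (ht1 : t ≤ 1) :
    |(1 + z) ^ t - 1| ≤ |z| := by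
  have h1 : 0 ≤ 1 + z := by linarith
  rcases le_total 0 z with h | h
  · have := Real.one_le_rpow (x := 1 + z) (by linarith) ht0
    have := Real.rpow_le_rpow_of_exponent_le (x := 1 + z) (by linarith) ht1
    rw [Real.rpow_one] at this
    rw [abs_of_nonneg h, abs_of_nonneg] <;> linarith
  · have := Real.rpow_le_one h1 (by linarith) ht0
    have := Real.self_le_rpow_of_le_one h1 (by linarith) ht1
    rw [abs_of_nonpos h, abs_of_nonpos] <;> linarith

theorem abs_cosh_add_mul_sinh_rpow_sub_le {u t x : ℝ} (ht0 : 0 ≤ t) (ht1 : t ≤ 1) (hx : |x| ≤ 1) :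
    |(Real.cosh u + x * Real.sinh u) ^ t - Real.cosh u ^ t| ≤ Real.cosh u ^ t * |x| := by
  have hc := Real.cosh_pos u
  have hs : |Real.sinh u| ≤ Real.cosh u :=
    abs_le_of_sq_le_sq (by nlinarith [Real.cosh_sq u]) hc.le
  set z := x * (Real.sinh u / Real.cosh u)
  have hz : |z| ≤ |x| := by
    rw [abs_mul, abs_div, abs_of_pos hc]
    exact mul_le_of_le_one_right (abs_nonneg x) ((div_le_one hc).2 hs)
  have hz1 : -1 ≤ z := (abs_le.1 (hz.trans hx)).1
  have he : Real.cosh u + x * Real.sinh u = Real.cosh u * (1 + z) := by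
    simp only [z]
    field_simp
  rw [he, Real.mul_rpow hc.le (by linarith), ← mul_sub_one, abs_mul,
    abs_of_pos (Real.rpow_pos_of_pos hc t)]
  exact mul_le_mul_of_nonneg_left ((abs_one_add_rpow_sub_one_le hz1 ht0 ht1).trans hz)
    (Real.rpow_nonneg hc.le t)

/-- concentration of measure:
`∫_{S^{n-1}} (cosh u + b₁ sinh u)ᵗ dσ_n(b) → (cosh u)ᵗ` as `n → ∞`. -/
theorem sphere_integral_tendsto (u t : ℝ) (hu : 0 ≤ u) (ht0 : 0 < t) (ht1 : t ≤ 1) :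
    Filter.Tendsto
      (fun n : ℕ =>
        ∫ b : Metric.sphere (0 : EuclideanSpace ℝ (Fin (n + 2))) 1,
          (Real.cosh u + (b : EuclideanSpace ℝ (Fin (n + 2))) 0 * Real.sinh u) ^ t
          ∂(sphereProb (n + 2)))
      Filter.atTop (nhds ((Real.cosh u) ^ t)) := by
  have hlim : Filter.Tendsto (fun n : ℕ => Real.cosh u ^ t * (1 / √(((n + 1 : ℕ) : ℝ) + 1)))
      Filter.atTop (nhds 0) := by
    rw [← mul_zero (Real.cosh u ^ t)]
    refine Filter.Tendsto.const_mul _ ?_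
    simp only [one_div]
    refine (Real.tendsto_sqrt_atTop.comp ?_).inv_tendsto_atTop
    exact Filter.tendsto_atTop_add_const_right _ _
      (tendsto_natCast_atTop_atTop.comp (Filter.tendsto_add_atTop_nat 1))
  refine tendsto_iff_dist_tendsto_zero.2 (squeeze_zero (fun _ => dist_nonneg) (fun n => ?_) hlim)
  have hcont : Continuous fun b : Metric.sphere (0 : EuclideanSpace ℝ (Fin (n + 2))) 1 =>
      (Real.cosh u + (b : EuclideanSpace ℝ (Fin (n + 2))) 0 * Real.sinh u) ^ t :=
    Continuous.rpow_const (by fun_prop) fun _ => Or.inr ht0.le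
  have hconst : Real.cosh u ^ t = ∫ _, Real.cosh u ^ t ∂sphereProb (n + 2) := by simp
  rw [Real.dist_eq]
  nth_rw 1 [hconst]
  rw [← integral_sub (integrable_sphereProb_of_continuous (n + 1) hcont) (integrable_const _)]
  calc
    _ ≤ ∫ b, |(Real.cosh u + (b : EuclideanSpace ℝ (Fin (n + 2))) 0 * Real.sinh u) ^ t
          - Real.cosh u ^ t| ∂sphereProb (n + 2) := abs_integral_le_integral_abs
    _ ≤ ∫ b, Real.cosh u ^ t * |(b : EuclideanSpace ℝ (Fin (n + 2))) 0| ∂sphereProb (n + 2) := by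
      refine integral_mono
        (integrable_sphereProb_of_continuous (n + 1) (hcont.sub continuous_const).abs)
        (integrable_sphereProb_of_continuous (n + 1) (by fun_prop)) fun b => ?_
      refine abs_cosh_add_mul_sinh_rpow_sub_le ht0.le ht1 ?_
      simpa using PiLp.norm_apply_le (b : EuclideanSpace ℝ (Fin (n + 2))) 0
    _ ≤ _ := by
      rw [integral_const_mul]
      gcongr
      exact integral_sphereProb_abs_coord_le (n + 1) 0
end

section
/- Fix u ≥ 0, 0 < t ≤ 1, and an integer n ≥ 2. Let σ_n denote the normalized (probability) surface measure on the unit sphere S^{n−1} ⊂ ℝⁿ and let b₁ denote the first coordinate of b ∈ S^{n−1}. Then ∫_{S^{n−1}} ( cosh u − b₁·sinh u )^{−(n−1+t)} dσ_n(b) = ∫_{S^{n−1}} ( cosh u + b₁·sinh u )^{t} dσ_n(b). -/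
open MeasureTheory

open Real Set Module Metric
open scoped ENNReal RealInnerProductSpace

/-- `‖x‖` and the component of `x` along `e` are transformed by the Lorentz boost of rapidity `u`,
while the component orthogonal to `e` is fixed. -/
noncomputable def lightConeBoost {E : Type*} [NormedAddCommGroup E] [InnerProductSpace ℝ E]
    (e : E) (u : ℝ) (x : E) : E :=
  x + ((cosh u - 1) * ⟪e, x⟫ + sinh u * ‖x‖) • e

section Boost

variable {E : Type*} [NormedAddCommGroup E] [InnerProductSpace ℝ E] {e : E}

lemma cosh_mul_norm_add_sinh_mul_inner_pos (he : ‖e‖ = 1) (u : ℝ) {x : E} (hx : x ≠ 0) :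
    0 < cosh u * ‖x‖ + sinh u * ⟪e, x⟫ := by
  have hin : |⟪e, x⟫| ≤ ‖x‖ := by simpa [he] using abs_real_inner_le_norm e x
  have hs : |sinh u| < cosh u := abs_lt.2
    ⟨by linarith [exp_pos u, cosh_add_sinh u], by linarith [exp_pos (-u), cosh_sub_sinh u]⟩
  have hmul : |sinh u * ⟪e, x⟫| ≤ |sinh u| * ‖x‖ := by
    rw [abs_mul]
    gcongr
  have hlt : |sinh u| * ‖x‖ < cosh u * ‖x‖ := by
    gcongr
  linarith [neg_abs_le (sinh u * ⟪e, x⟫)]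

lemma cosh_mul_norm_sub_sinh_mul_inner_pos (he : ‖e‖ = 1) (u : ℝ) {x : E} (hx : x ≠ 0) :
    0 < cosh u * ‖x‖ - sinh u * ⟪e, x⟫ := by
  simpa [sub_eq_add_neg] using cosh_mul_norm_add_sinh_mul_inner_pos he (-u) hx

lemma inner_lightConeBoost (he : ‖e‖ = 1) (u : ℝ) (x : E) :
    ⟪e, lightConeBoost e u x⟫ = cosh u * ⟪e, x⟫ + sinh u * ‖x‖ := by
  rw [lightConeBoost, inner_add_right, inner_smul_right, real_inner_self_eq_norm_sq, he]
  ring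

lemma norm_lightConeBoost (he : ‖e‖ = 1) (u : ℝ) (x : E) :
    ‖lightConeBoost e u x‖ = cosh u * ‖x‖ + sinh u * ⟪e, x⟫ := by
  have hnonneg : 0 ≤ cosh u * ‖x‖ + sinh u * ⟪e, x⟫ := by
    obtain rfl | hx := eq_or_ne x 0
    · simp
    · exact (cosh_mul_norm_add_sinh_mul_inner_pos he u hx).le
  refine (sq_eq_sq₀ (norm_nonneg _) hnonneg).1 ?_
  rw [lightConeBoost, norm_add_sq_real, norm_smul, he, inner_smul_right, real_inner_comm e x, mul_one,
    norm_eq_abs, sq_abs]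
  linear_combination (⟪e, x⟫ ^ 2 - ‖x‖ ^ 2) * cosh_sq u

lemma lightConeBoost_neg_lightConeBoost (he : ‖e‖ = 1) (u : ℝ) (x : E) :
    lightConeBoost e (-u) (lightConeBoost e u x) = x := by
  rw [lightConeBoost, inner_lightConeBoost he, norm_lightConeBoost he, lightConeBoost, add_assoc,
    ← add_smul, add_eq_left, cosh_neg, sinh_neg]
  convert zero_smul ℝ e
  linear_combination ⟪e, x⟫ * cosh_sq u

lemma lightConeBoost_ne_zero (he : ‖e‖ = 1) (u : ℝ) {x : E} (hx : x ≠ 0) :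
    lightConeBoost e u x ≠ 0 := by
  rw [← norm_pos_iff, norm_lightConeBoost he]
  exact cosh_mul_norm_add_sinh_mul_inner_pos he u hx

lemma image_lightConeBoost_compl_zero (he : ‖e‖ = 1) (u : ℝ) :
    lightConeBoost e u '' {0}ᶜ = {0}ᶜ := by
  refine Subset.antisymm (image_subset_iff.2 fun x hx ↦ lightConeBoost_ne_zero he u hx) fun x hx ↦
    ⟨lightConeBoost e (-u) x, lightConeBoost_ne_zero he (-u) hx, ?_⟩
  simpa using lightConeBoost_neg_lightConeBoost he (-u) x

lemma hasFDerivAt_lightConeBoost (e : E) (u : ℝ) {x : E} (hx : x ≠ 0) :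
    HasFDerivAt (lightConeBoost e u) (ContinuousLinearMap.id ℝ E +
      ((cosh u - 1) • innerSL ℝ e + (sinh u / ‖x‖) • innerSL ℝ x).smulRight e) x := by
  have hnorm : HasFDerivAt (fun y : E ↦ ‖y‖) ((1 / ‖x‖) • innerSL ℝ x) x := by
    have h := (hasStrictFDerivAt_norm_sq x).hasFDerivAt.sqrt (by simpa using hx)
    simp only [sqrt_sq (norm_nonneg _)] at h
    convert! h using 1
    ext y
    simp
    field_simp
  have h := (((innerSL ℝ e).hasFDerivAt (x := x)).const_mul (cosh u - 1)).add
    (hnorm.const_mul (sinh u))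
  convert! (hasFDerivAt_id x).add (h.smul_const e) using 1
  simp [smul_smul, div_eq_mul_inv]

lemma det_fderiv_lightConeBoost [FiniteDimensional ℝ E] (he : ‖e‖ = 1) (u : ℝ) (x : E) :
    (ContinuousLinearMap.id ℝ E +
      ((cosh u - 1) • innerSL ℝ e + (sinh u / ‖x‖) • innerSL ℝ x).smulRight e).det =
      cosh u + sinh u / ‖x‖ * ⟪e, x⟫ := by
  have h := LinearMap.transvection.det
    (((cosh u - 1) • innerSL ℝ e + (sinh u / ‖x‖) • innerSL ℝ x : E →L[ℝ] ℝ) : E →ₗ[ℝ] ℝ) e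
  refine (h : LinearMap.det (LinearMap.transvection _ e) = _).trans ?_
  simp [he, real_inner_comm]
  ring

end Boost

section Polar

variable {E : Type*} [NormedAddCommGroup E] [InnerProductSpace ℝ E] [FiniteDimensional ℝ E]
  [MeasurableSpace E] [BorelSpace E] (μ : Measure E) [μ.IsAddHaarMeasure]

lemma setLIntegral_compl_zero_eq_lintegral_toSphere {f : E → ℝ≥0∞} (hf : Measurable f) :
    ∫⁻ x in {0}ᶜ, f x ∂μ = ∫⁻ θ, ∫⁻ r : Ioi (0 : ℝ), f (r.1 • θ.1)
      ∂(Measure.volumeIoiPow (finrank ℝ E - 1)) ∂μ.toSphere := by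
  rw [← lintegral_subtype_comap (measurableSet_singleton _).compl,
    ← lintegral_prod (fun p : sphere (0 : E) 1 × Ioi (0 : ℝ) ↦ f (p.2.1 • p.1.1))
      (by fun_prop),
    ← μ.measurePreserving_homeomorphUnitSphereProd.lintegral_comp (by fun_prop)]
  refine lintegral_congr fun x ↦ ?_
  have hx : ‖x.1‖ ≠ 0 := norm_ne_zero_iff.2 x.2
  simp [smul_smul, hx]

lemma setLIntegral_compl_zero_of_radial_indicator [Nontrivial E] {f : E → ℝ≥0∞}
    (hf : Measurable f) {g : sphere (0 : E) 1 → ℝ≥0∞} {ρ : sphere (0 : E) 1 → ℝ}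
    (hρ : ∀ θ, 0 < ρ θ)
    (hfg : ∀ (θ : sphere (0 : E) 1) (r : ℝ), 0 < r →
      f (r • θ.1) = if r < ρ θ then g θ else 0) :
    ∫⁻ x in {0}ᶜ, f x ∂μ =
      (∫⁻ θ, g θ * .ofReal (ρ θ ^ finrank ℝ E) ∂μ.toSphere) * .ofReal (1 / finrank ℝ E) := by
  have hdim : 0 < finrank ℝ E := finrank_pos
  rw [setLIntegral_compl_zero_eq_lintegral_toSphere μ hf, ← lintegral_mul_const' _ _ (by simp)]
  refine lintegral_congr fun θ ↦ ?_
  have hind : (fun r : Ioi (0 : ℝ) ↦ f (r.1 • θ.1)) =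
      (Iio ⟨ρ θ, hρ θ⟩).indicator fun _ ↦ g θ := by
    ext r
    simp only [hfg θ r r.2, indicator_apply, mem_Iio, ← Subtype.coe_lt_coe]
  rw [hind, lintegral_indicator_const measurableSet_Iio, Measure.volumeIoiPow_apply_Iio,
    Nat.sub_add_cancel hdim, Nat.cast_pred hdim, sub_add_cancel, mul_assoc,
    ← ENNReal.ofReal_mul (pow_nonneg (hρ θ).le _), mul_one_div]

/-- Change of variables on the unit sphere, obtained by writing the integral of a homogeneous
function and its pullback along `lightConeBoost` in polar coordinates. -/
theorem lintegral_toSphere_cosh_sub_rpow [Nontrivial E] {e : E} (he : ‖e‖ = 1) (u t : ℝ) :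
    ∫⁻ θ, .ofReal ((cosh u - ⟪e, θ.1⟫ * sinh u) ^ (-((finrank ℝ E : ℝ) - 1 + t))) ∂μ.toSphere =
      ∫⁻ θ, .ofReal ((cosh u + ⟪e, θ.1⟫ * sinh u) ^ t) ∂μ.toSphere := by
  have hadd (θ : sphere (0 : E) 1) : 0 < cosh u + ⟪e, θ.1⟫ * sinh u := by
    have h := cosh_mul_norm_add_sinh_mul_inner_pos he u (ne_zero_of_mem_unit_sphere θ)
    simpa [mul_comm] using h
  have hsub (θ : sphere (0 : E) 1) : 0 < cosh u - ⟪e, θ.1⟫ * sinh u := by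
    have h := cosh_mul_norm_sub_sinh_mul_inner_pos he u (ne_zero_of_mem_unit_sphere θ)
    simpa [mul_comm] using h
  let F : E → ℝ≥0∞ := fun y ↦ if cosh u * ‖y‖ - sinh u * ⟪e, y⟫ < 1 then
    .ofReal (((cosh u * ‖y‖ - sinh u * ⟪e, y⟫) / ‖y‖) ^ (1 - t)) else 0
  have hF : Measurable F :=
    Measurable.ite (measurableSet_lt (by fun_prop) (by fun_prop)) (by fun_prop) (by fun_prop)
  let G : E → ℝ≥0∞ := fun x ↦ .ofReal |cosh u + sinh u / ‖x‖ * ⟪e, x⟫| *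
    if ‖x‖ < 1 then .ofReal ((‖x‖ / (cosh u * ‖x‖ + sinh u * ⟪e, x⟫)) ^ (1 - t)) else 0
  have hG : Measurable G := by
    refine Measurable.mul (by fun_prop) ?_
    exact Measurable.ite (measurableSet_lt (by fun_prop) (by fun_prop)) (by fun_prop) (by fun_prop)
  have hFG : ∫⁻ y in {0}ᶜ, F y ∂μ = ∫⁻ x in {0}ᶜ, G x ∂μ := by
    have h := lintegral_image_eq_lintegral_abs_det_fderiv_mul μ
      (measurableSet_singleton (0 : E)).compl
      (fun x hx ↦ (hasFDerivAt_lightConeBoost e u hx).hasFDerivWithinAt)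
      (Function.LeftInverse.injective (lightConeBoost_neg_lightConeBoost he u)).injOn F
    rw [image_lightConeBoost_compl_zero he] at h
    rw [h]
    refine lintegral_congr fun x ↦ ?_
    have hx : cosh u * ‖lightConeBoost e u x‖ - sinh u * ⟪e, lightConeBoost e u x⟫ = ‖x‖ := by
      rw [norm_lightConeBoost he, inner_lightConeBoost he]
      linear_combination ‖x‖ * cosh_sq u
    simp only [F, hx]
    rw [det_fderiv_lightConeBoost he, norm_lightConeBoost he]
  have hL := setLIntegral_compl_zero_of_radial_indicator μ hF
    (g := fun θ ↦ .ofReal ((cosh u - ⟪e, θ.1⟫ * sinh u) ^ (1 - t)))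
    (ρ := fun θ ↦ (cosh u - ⟪e, θ.1⟫ * sinh u)⁻¹) (fun θ ↦ inv_pos.2 (hsub θ)) fun θ r hr ↦ by
      have hr' : cosh u * ‖r • θ.1‖ - sinh u * ⟪e, r • θ.1⟫ =
          r * (cosh u - ⟪e, θ.1⟫ * sinh u) := by
        simp only [norm_smul, norm_eq_of_mem_sphere, norm_eq_abs, abs_of_pos hr, inner_smul_right]
        ring
      simp only [F, hr', ← lt_div_iff₀ (hsub θ), one_div]
      simp [norm_smul, abs_of_pos hr, hr.ne']
  have hR := setLIntegral_compl_zero_of_radial_indicator μ hG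
    (g := fun θ ↦ .ofReal ((cosh u + ⟪e, θ.1⟫ * sinh u) ^ t))
    (ρ := fun _ ↦ 1) (fun _ ↦ one_pos) fun θ r hr ↦ by
      have hnorm : ‖r • θ.1‖ = r := by simp [norm_smul, abs_of_pos hr]
      have hden : cosh u * r + sinh u * ⟪e, r • θ.1⟫ = r * (cosh u + ⟪e, θ.1⟫ * sinh u) := by
        rw [inner_smul_right]
        ring
      have hdet : cosh u + sinh u / r * ⟪e, r • θ.1⟫ = cosh u + ⟪e, θ.1⟫ * sinh u := by
        rw [inner_smul_right]
        field_simp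
      have hquot : r / (r * (cosh u + ⟪e, θ.1⟫ * sinh u)) = (cosh u + ⟪e, θ.1⟫ * sinh u)⁻¹ := by
        rw [div_mul_cancel_left₀ hr.ne']
      simp only [G, hnorm, hden, hdet, hquot, mul_ite, mul_zero]
      rw [abs_of_pos (hadd θ), ← ENNReal.ofReal_mul (hadd θ).le, inv_rpow (hadd θ).le,
        ← rpow_neg (hadd θ).le, mul_comm, ← rpow_add_one (hadd θ).ne', neg_sub, sub_add_cancel]
  rw [hFG, hR, ENNReal.mul_left_inj (by simp [finrank_pos]) (by simp)] at hL
  simp only [one_pow, ENNReal.ofReal_one, mul_one] at hL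
  rw [hL]
  refine lintegral_congr fun θ ↦ ?_
  rw [← ENNReal.ofReal_mul (rpow_nonneg (hsub θ).le _), inv_pow, ← rpow_natCast,
    ← rpow_neg (hsub θ).le, ← rpow_add (hsub θ)]
  ring_nf

end Polar

/-- change of variables on the sphere:
`∫ (cosh u − b₁ sinh u)^{-(n-1+t)} dσ_n = ∫ (cosh u + b₁ sinh u)ᵗ dσ_n`. -/
theorem sphere_integral_change_of_variables (u t : ℝ) (hu : 0 ≤ u) (ht0 : 0 < t)
    (ht1 : t ≤ 1) (n : ℕ) (hn : 2 ≤ n) :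
    (∫ b : Metric.sphere (0 : EuclideanSpace ℝ (Fin n)) 1,
        (Real.cosh u - (b : EuclideanSpace ℝ (Fin n)) ⟨0, by omega⟩ * Real.sinh u) ^
          (-((n : ℝ) - 1 + t)) ∂(sphereProb n)) =
      ∫ b : Metric.sphere (0 : EuclideanSpace ℝ (Fin n)) 1,
        (Real.cosh u + (b : EuclideanSpace ℝ (Fin n)) ⟨0, by omega⟩ * Real.sinh u) ^ t
          ∂(sphereProb n) := by
  have : Nonempty (Fin n) := ⟨⟨0, by omega⟩⟩
  let e : EuclideanSpace ℝ (Fin n) := EuclideanSpace.single ⟨0, by omega⟩ 1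
  have he : ‖e‖ = 1 := by simp [e]
  have hinner (x : EuclideanSpace ℝ (Fin n)) : x ⟨0, by omega⟩ = ⟪e, x⟫ := by
    simp [e, EuclideanSpace.inner_single_left]
  simp only [hinner]
  have hadd (b : sphere (0 : EuclideanSpace ℝ (Fin n)) 1) :
      0 ≤ cosh u + ⟪e, b.1⟫ * sinh u := by
    have h := cosh_mul_norm_add_sinh_mul_inner_pos he u (ne_zero_of_mem_unit_sphere b)
    simpa [mul_comm] using h.le
  have hsub (b : sphere (0 : EuclideanSpace ℝ (Fin n)) 1) :
      0 ≤ cosh u - ⟪e, b.1⟫ * sinh u := by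
    have h := cosh_mul_norm_sub_sinh_mul_inner_pos he u (ne_zero_of_mem_unit_sphere b)
    simpa [mul_comm] using h.le
  have h := lintegral_toSphere_cosh_sub_rpow (volume : Measure (EuclideanSpace ℝ (Fin n))) he u t
  rw [finrank_euclideanSpace_fin] at h
  rw [integral_eq_lintegral_of_nonneg_ae (.of_forall fun b ↦ rpow_nonneg (hsub b) _)
      (Measurable.aestronglyMeasurable (by fun_prop)),
    integral_eq_lintegral_of_nonneg_ae (.of_forall fun b ↦ rpow_nonneg (hadd b) _)
      (Measurable.aestronglyMeasurable (by fun_prop)), sphereProb, lintegral_smul_measure,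
    lintegral_smul_measure, h]
end
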